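/- arXiv:1512.07138 — 2 statements merged into one kernel-verified Lean document; each statement's English description precedes it below -/
import Mathlib

section
/- Let g satisfy (g*), (g₀), (g∞) and let a be a locally integrable periodic function of minimal period T > 0 satisfying (a*). Then for every ρ > 0 there exists λ* = λ*(ρ) > 0 such that for each λ > λ* there exist r, R with 0 < r < ρ < R and μ*(λ) > 0 such that for any μ > μ*(λ) the following holds: for every two-sided sequence S = (S_j)_{j∈ℤ} ∈ {0,1,2}^ℤ which is not identically zero there exists a solution u of u'' + (λa⁺(t) − μa⁻(t)) g(u) = 0 defined on all of ℝ with u(t) > 0 for all t such that, writing j = i + ℓm for i ∈ {1,…,m} and ℓ ∈ ℤ and I⁺_{i,ℓ} := I⁺_i + ℓT: max_{t∈I⁺_{i,ℓ}} u(t) < r if S_j = 0; r < max_{t∈I⁺_{i,ℓ}} u(t) < ρ if S_j = 1; and ρ < max_{t∈I⁺_{i,ℓ}} u(t) < R if S_j = 2. -/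
open MeasureTheory Set Filter Topology

/-- A Carathéodory solution of `u'' + q(t) G(u) = 0` on all of `ℝ`:
`u` is `C¹` with derivative `v`, and `v t = v t₀ - ∫_{t₀}^{t} q s * G (u s) ds`. -/
def IsSolR (q G u v : ℝ → ℝ) : Prop :=
  (∀ t, HasDerivAt u (v t) t) ∧
    ∀ t₀ t : ℝ, v t = v t₀ - ∫ s in t₀..t, q s * G (u s)

/-- A drift-kick discretisation of `u'' + Q'(t) h(u) = 0` on the grid `x`: the position `u` is
piecewise affine with slope `v i` between `x i` and `x (i + 1)`, and the slope jumps by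
`-(Q (i + 1) - Q i) * h (u (i + 1))` at the grid point `x (i + 1)`. -/
structure IsKick (x Q : ℕ → ℝ) (h : ℝ → ℝ) (u v : ℕ → ℝ) : Prop where
  drift : ∀ i, u (i + 1) = u i + (x (i + 1) - x i) * v i
  kick : ∀ i, v (i + 1) = v i - (Q (i + 1) - Q i) * h (u (i + 1))

namespace IsKick

variable {x Q u v : ℕ → ℝ} {h : ℝ → ℝ}

lemma le_pos (H : IsKick x Q h u v) (hx : ∀ i, x i < x (i + 1)) {a b : ℕ} (hab : a ≤ b) {c : ℝ}
    (hv : ∀ i, a ≤ i → i < b → c ≤ v i) : u a + c * (x b - x a) ≤ u b := by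
  induction b, hab using Nat.le_induction with
  | base => simp
  | succ k hk ih =>
    have h1 := ih fun i hi hik => hv i hi (by omega)
    have h2 := mul_le_mul_of_nonneg_left (hv k hk (by omega)) (sub_pos.2 (hx k)).le
    rw [H.drift k]
    nlinarith

lemma pos_le (H : IsKick x Q h u v) (hx : ∀ i, x i < x (i + 1)) {a b : ℕ} (hab : a ≤ b) {c : ℝ}
    (hv : ∀ i, a ≤ i → i < b → v i ≤ c) : u b ≤ u a + c * (x b - x a) := by
  induction b, hab using Nat.le_induction with
  | base => simp
  | succ k hk ih =>
    have h1 := ih fun i hi hik => hv i hi (by omega)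
    have h2 := mul_le_mul_of_nonneg_left (hv k hk (by omega)) (sub_pos.2 (hx k)).le
    rw [H.drift k]
    nlinarith

lemma vel_le (H : IsKick x Q h u v) {a b : ℕ} (hab : a ≤ b) {c : ℝ}
    (hQ : ∀ i, a ≤ i → i < b → Q i ≤ Q (i + 1)) (hc : ∀ i, a ≤ i → i < b → c ≤ h (u (i + 1))) :
    v b ≤ v a - c * (Q b - Q a) := by
  induction b, hab using Nat.le_induction with
  | base => simp
  | succ k hk ih =>
    have h1 := ih (fun i hi hik => hQ i hi (by omega)) fun i hi hik => hc i hi (by omega)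
    have h2 := mul_le_mul_of_nonneg_left (hc k hk (by omega))
      (sub_nonneg.2 (hQ k hk (by omega)))
    rw [H.kick k]
    nlinarith

lemma le_vel (H : IsKick x Q h u v) {a b : ℕ} (hab : a ≤ b) {c : ℝ}
    (hQ : ∀ i, a ≤ i → i < b → Q i ≤ Q (i + 1)) (hc : ∀ i, a ≤ i → i < b → h (u (i + 1)) ≤ c) :
    v a - c * (Q b - Q a) ≤ v b := by
  induction b, hab using Nat.le_induction with
  | base => simp
  | succ k hk ih =>
    have h1 := ih (fun i hi hik => hQ i hi (by omega)) fun i hi hik => hc i hi (by omega)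
    have h2 := mul_le_mul_of_nonneg_left (hc k hk (by omega))
      (sub_nonneg.2 (hQ k hk (by omega)))
    rw [H.kick k]
    nlinarith

lemma le_vel_of_antitone (H : IsKick x Q h u v) {a b : ℕ} (hab : a ≤ b) {c : ℝ}
    (hQ : ∀ i, a ≤ i → i < b → Q (i + 1) ≤ Q i) (hc : ∀ i, a ≤ i → i < b → c ≤ h (u (i + 1))) :
    v a + c * (Q a - Q b) ≤ v b := by
  induction b, hab using Nat.le_induction with
  | base => simp
  | succ k hk ih =>
    have h1 := ih (fun i hi hik => hQ i hi (by omega)) fun i hi hik => hc i hi (by omega)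
    have h2 := mul_le_mul_of_nonneg_left (hc k hk (by omega))
      (sub_nonneg.2 (hQ k hk (by omega)))
    rw [H.kick k]
    nlinarith

/-- On a block where `Q` increases the slopes decrease. -/
lemma vel_anti (H : IsKick x Q h u v) (hh : ∀ s, 0 ≤ h s) {a b : ℕ}
    (hQ : ∀ i, a ≤ i → i < b → Q i ≤ Q (i + 1)) {i j : ℕ} (hai : a ≤ i) (hij : i ≤ j)
    (hjb : j ≤ b) : v j ≤ v i := by
  simpa using H.vel_le hij (c := 0) (fun k _ _ => hQ k (by omega) (by omega)) fun _ _ _ => hh _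

/-- On a block where `Q` decreases the slopes increase. -/
lemma vel_mono (H : IsKick x Q h u v) (hh : ∀ s, 0 ≤ h s) {a b : ℕ}
    (hQ : ∀ i, a ≤ i → i < b → Q (i + 1) ≤ Q i) {i j : ℕ} (hai : a ≤ i) (hij : i ≤ j)
    (hjb : j ≤ b) : v i ≤ v j := by
  simpa using H.le_vel_of_antitone hij (c := 0) (fun k _ _ => hQ k (by omega) (by omega))
    fun _ _ _ => hh _

/-- Discrete concavity on a block where `Q` increases. -/
lemma concave (H : IsKick x Q h u v) (hx : ∀ i, x i < x (i + 1)) (hh : ∀ s, 0 ≤ h s) {a b : ℕ}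
    (hQ : ∀ i, a ≤ i → i < b → Q i ≤ Q (i + 1)) {i j k : ℕ} (hai : a ≤ i) (hij : i ≤ j)
    (hjk : j ≤ k) (hkb : k ≤ b) : (x j - x i) * (u k - u j) ≤ (x k - x j) * (u j - u i) := by
  have hmono : Monotone x := monotone_nat_of_le_succ fun i => (hx i).le
  have h1 := H.le_pos hx hij (c := v j)
    fun l hl hlj => H.vel_anti hh hQ (by omega) hlj.le (by omega)
  have h2 := H.pos_le hx hjk (c := v j)
    fun l hl hlj => H.vel_anti hh hQ (by omega) hl (by omega)
  have h3 := sub_nonneg.2 (hmono hij)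
  have h4 := sub_nonneg.2 (hmono hjk)
  nlinarith [mul_le_mul_of_nonneg_left (sub_nonneg.2 h2) h3,
    mul_le_mul_of_nonneg_left (sub_nonneg.2 h1) h4]

/-- A nonnegative trajectory that starts with negative slope can vanish only at the end, and it
then leaves the half-line of nonnegative positions for good. -/
lemma pos_le_zero_of_eq_zero (H : IsKick x Q h u v) (hx : ∀ i, x i < x (i + 1))
    (h0 : ∀ s ≤ 0, h s = 0) (hv0 : v 0 < 0) {K : ℕ} (hu : ∀ k ≤ K, 0 ≤ u k) {k₀ : ℕ}
    (hk₀ : k₀ ≤ K) (huk₀ : u k₀ = 0) : ∀ i, K ≤ i → u i ≤ 0 := by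
  have key : ∀ k ≤ K, u k = 0 → v k < 0 := by
    intro k
    induction k with
    | zero => exact fun _ _ => hv0
    | succ k ih =>
      intro hk huk
      have h1 := H.kick k
      rw [huk, h0 0 le_rfl, mul_zero, sub_zero] at h1
      have h2 := H.drift k
      have h3 := hu k (by omega)
      have h4 := sub_pos.2 (hx k)
      rw [h1]
      rcases lt_trichotomy (v k) 0 with h5 | h5 | h5
      · exact h5
      · rw [h5] at h2
        exact absurd (ih (by omega) (by linarith)) (by rw [h5]; exact lt_irrefl _)
      · nlinarith [mul_pos h4 h5]
  have hK : k₀ = K := by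
    by_contra hne
    have h1 := H.drift k₀
    have h2 := hu (k₀ + 1) (by omega)
    have h3 := key k₀ hk₀ huk₀
    have h4 := sub_pos.2 (hx k₀)
    nlinarith [mul_neg_of_pos_of_neg h4 h3]
  subst hK
  have : ∀ i, k₀ ≤ i → u i ≤ 0 ∧ v i < 0 := by
    intro i hi
    induction i, hi using Nat.le_induction with
    | base => exact ⟨huk₀.le, key _ le_rfl huk₀⟩
    | succ k hk ih =>
      have h4 := sub_pos.2 (hx k)
      have h5 : u (k + 1) ≤ 0 := by
        rw [H.drift k]; nlinarith [mul_neg_of_pos_of_neg h4 ih.2]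
      exact ⟨h5, by rw [H.kick k, h0 _ h5]; linarith [ih.2]⟩
  exact fun i hi => (this i hi).1

end IsKick

/-- The constants governing the shooting argument: bounds `l₀ ≤ · ≤ L` on the lengths of the
intervals, a margin `ε`, bounds `LA`, `LB` on the mass of the positive part of the weight and `MB`
on that of its negative part, lower bounds `c`, `c₁` for the nonlinearity, and the thresholds
`z₀ < z₁ < z₂ < z₃ < z₄` for the maxima. -/
structure ShootingConstants where
  (l₀ L ε LA LB MB c c₁ z₀ z₁ z₂ z₃ z₄ : ℝ)

namespace ShootingConstants

/-- The bound for the slopes of the trajectories which stay below `z₄`. -/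
noncomputable def slope (p : ShootingConstants) : ℝ := p.z₄ / p.l₀ + p.z₄ / (4 * p.L)

/-- Compatibility of a nonlinearity `h` with the constants. -/
structure Nonlinearity (p : ShootingConstants) (h : ℝ → ℝ) : Prop where
  l₀_pos : 0 < p.l₀
  L_pos : 0 < p.L
  ε_pos : 0 < p.ε
  LA_pos : 0 < p.LA
  z₀_pos : 0 < p.z₀
  z₀_lt : p.z₀ < p.z₁
  z₁_lt : p.z₁ < p.z₂
  z₂_lt : p.z₂ < p.z₃
  z₃_lt : p.z₃ < p.z₄
  c_pos : 0 < p.c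
  c₁_pos : 0 < p.c₁
  cont : Continuous h
  nonneg : ∀ s, 0 ≤ h s
  eq_zero : ∀ s ≤ 0, h s = 0
  le_z₀ : ∀ s ≤ p.z₀, h s ≤ p.z₀ / (4 * p.L * p.LA)
  le_z₁ : ∀ s ≤ p.z₁, h s ≤ p.z₁ / (4 * p.L * p.LA)
  le_z₄ : ∀ s, h s ≤ p.z₄ / (4 * p.L * p.LA)
  c_le : ∀ s, p.z₀ / 4 ≤ s → p.c ≤ h s
  c₁_le : ∀ s, p.z₂ * p.ε / p.L ≤ s → s ≤ p.z₃ → p.c₁ ≤ h s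
  lt_LB : 2 * p.z₃ / p.ε < p.c₁ * p.LB
  le_MB : 2 * p.slope ≤ p.c * p.MB

/-- Compatibility of a grid `x` and of the values `Q` of a primitive of the weight with the
constants. The grid is cut into blocks by `K`; the weight is nonpositive on the blocks of even index
and nonnegative on those of odd index. -/
structure Grid (p : ShootingConstants) (x Q : ℕ → ℝ) (K n₁ n₂ : ℕ → ℕ) : Prop where
  lt_succ : ∀ i, x i < x (i + 1)
  K_zero : K 0 = 0
  K_mono : Monotone K
  minus : ∀ l i, K (2 * l) ≤ i → i < K (2 * l + 1) → Q (i + 1) ≤ Q i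
  plus : ∀ l i, K (2 * l + 1) ≤ i → i < K (2 * l + 2) → Q i ≤ Q (i + 1)
  len_minus : ∀ l, x (K (2 * l + 1)) - x (K (2 * l)) ≤ p.L
  len_plus : ∀ l, x (K (2 * l + 2)) - x (K (2 * l + 1)) ≤ p.L
  le_len_plus : ∀ l, p.l₀ ≤ x (K (2 * l + 2)) - x (K (2 * l + 1))
  mass_minus : ∀ l, p.MB ≤ Q (K (2 * l)) - Q (K (2 * l + 1))
  mass_plus : ∀ l, Q (K (2 * l + 2)) - Q (K (2 * l + 1)) ≤ p.LA
  K_le_n₁ : ∀ l, K (2 * l + 1) ≤ n₁ l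
  n₁_le_n₂ : ∀ l, n₁ l ≤ n₂ l
  n₂_le_K : ∀ l, n₂ l ≤ K (2 * l + 2)
  margin_left : ∀ l, p.ε ≤ x (n₁ l) - x (K (2 * l + 1))
  margin_right : ∀ l, p.ε ≤ x (K (2 * l + 2)) - x (n₂ l)
  mass_core : ∀ l, p.LB ≤ Q (n₂ l) - Q (n₁ l)

variable {p : ShootingConstants} {x Q u v : ℕ → ℝ} {h : ℝ → ℝ} {K n₁ n₂ : ℕ → ℕ}

lemma Nonlinearity.z₄_pos (hp : p.Nonlinearity h) : 0 < p.z₄ := by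
  linarith [hp.z₀_pos, hp.z₀_lt, hp.z₁_lt, hp.z₂_lt, hp.z₃_lt]

lemma Nonlinearity.slope_pos (hp : p.Nonlinearity h) : 0 < p.slope := by
  have := hp.z₄_pos
  have := hp.l₀_pos
  have := hp.L_pos
  unfold slope
  positivity

lemma Nonlinearity.le_slope (hp : p.Nonlinearity h) : p.z₄ / (4 * p.L) ≤ p.slope := by
  have := hp.z₄_pos
  have := hp.l₀_pos
  have : 0 < p.z₄ / p.l₀ := by positivity
  unfold slope
  linarith

lemma Nonlinearity.div_mul_LA (hp : p.Nonlinearity h) (ζ : ℝ) :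
    ζ / (4 * p.L * p.LA) * p.LA = ζ / (4 * p.L) := by
  have := hp.L_pos.ne'
  have := hp.LA_pos.ne'
  field_simp

lemma Grid.x_mono (hG : p.Grid x Q K n₁ n₂) : Monotone x :=
  monotone_nat_of_le_succ fun i => (hG.lt_succ i).le

lemma Grid.Q_mono (hG : p.Grid x Q K n₁ n₂) {l i j : ℕ} (hi : K (2 * l + 1) ≤ i) (hij : i ≤ j)
    (hj : j ≤ K (2 * l + 2)) : Q i ≤ Q j := by
  induction j, hij using Nat.le_induction with
  | base => exact le_rfl
  | succ k hk ih => exact (ih (by omega)).trans (hG.plus l k (by omega) (by omega))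

/-- Slope bounds on a block of nonnegative weight. -/
lemma abs_vel_le (hp : p.Nonlinearity h) (hG : p.Grid x Q K n₁ n₂) (H : IsKick x Q h u v) {l : ℕ}
    (hu : ∀ i, K (2 * l + 1) ≤ i → i ≤ K (2 * l + 2) → 0 ≤ u i ∧ u i ≤ p.z₄) {i : ℕ}
    (hi : K (2 * l + 1) ≤ i) (hi' : i ≤ K (2 * l + 2)) : |v i| ≤ p.slope := by
  set a := K (2 * l + 1)
  set b := K (2 * l + 2)
  have hab : a ≤ b := hG.K_mono (by omega)
  have hQ : ∀ i, a ≤ i → i < b → Q i ≤ Q (i + 1) := hG.plus l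
  have hlen : p.l₀ ≤ x b - x a := hG.le_len_plus l
  have hl₀ := hp.l₀_pos
  have h1 := H.pos_le hG.lt_succ hab (c := v a)
    fun k hk hk' => H.vel_anti hp.nonneg hQ le_rfl hk hk'.le
  have h2 := H.le_pos hG.lt_succ hab (c := v b)
    fun k hk hk' => H.vel_anti hp.nonneg hQ hk hk'.le le_rfl
  have h3 := H.le_vel hab hQ fun k _ _ => hp.le_z₄ (u (k + 1))
  have hz := hp.z₄_pos
  have h4 : p.z₄ / (4 * p.L * p.LA) * (Q b - Q a) ≤ p.z₄ / (4 * p.L) := by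
    rw [← hp.div_mul_LA]
    have := hp.L_pos
    have := hp.LA_pos
    exact mul_le_mul_of_nonneg_left (hG.mass_plus l) (by positivity)
  obtain ⟨ha0, ha4⟩ := hu a le_rfl hab
  obtain ⟨hb0, hb4⟩ := hu b hab le_rfl
  have h5 : -(p.z₄ / p.l₀) ≤ v a := by
    by_contra! hc
    have h6 : p.z₄ / p.l₀ * p.l₀ = p.z₄ := div_mul_cancel₀ _ hl₀.ne'
    have h7 : 0 < p.z₄ / p.l₀ := by positivity
    nlinarith
  have h5' : v b ≤ p.z₄ / p.l₀ := by
    by_contra! hc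
    have h6 : p.z₄ / p.l₀ * p.l₀ = p.z₄ := div_mul_cancel₀ _ hl₀.ne'
    have h7 : 0 < p.z₄ / p.l₀ := by positivity
    nlinarith
  have h8 := H.vel_anti hp.nonneg hQ le_rfl hi hi'
  have h9 := H.vel_anti hp.nonneg hQ hi hi' le_rfl
  rw [abs_le, slope]
  constructor <;> linarith

/-- A nonnegative trajectory cannot have its maximum between `z₂` and `z₃` on a block of
nonnegative weight. -/
lemma exists_neg_of_max (hp : p.Nonlinearity h) (hG : p.Grid x Q K n₁ n₂) (H : IsKick x Q h u v)
    {l : ℕ} {ζ : ℝ} (hζ : p.z₂ ≤ ζ) (hζ' : ζ ≤ p.z₃)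
    (hu : ∀ i, K (2 * l + 1) ≤ i → i ≤ K (2 * l + 2) → u i ≤ ζ)
    (hmax : ∃ k, K (2 * l + 1) ≤ k ∧ k ≤ K (2 * l + 2) ∧ u k = ζ) :
    ∃ k ≤ K (2 * l + 2), u k ≤ 0 := by
  by_contra! hpos
  obtain ⟨k, hak, hkb, huk⟩ := hmax
  have hn₁ := hG.K_le_n₁ l
  have hn₁₂ := hG.n₁_le_n₂ l
  have hn₂ := hG.n₂_le_K l
  have hL := hG.len_plus l
  have hm₁ := hG.margin_left l
  have hm₂ := hG.margin_right l
  have hQ : ∀ i, K (2 * l + 1) ≤ i → i < K (2 * l + 2) → Q i ≤ Q (i + 1) := hG.plus l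
  set a := K (2 * l + 1)
  set b := K (2 * l + 2)
  have hab : a ≤ b := hG.K_mono (by omega)
  have hε := hp.ε_pos
  have hLpos := hp.L_pos
  have hz₂ : 0 < p.z₂ := by linarith [hp.z₀_pos, hp.z₀_lt, hp.z₁_lt]
  have hζpos : 0 < ζ := hz₂.trans_le hζ
  have tent : ∀ i, n₁ l ≤ i → i ≤ n₂ l → p.z₂ * p.ε / p.L ≤ u i := by
    intro i hi hi'
    rw [div_le_iff₀ hLpos]
    have hui := hpos i (by omega)
    suffices p.ε * ζ ≤ u i * p.L by nlinarith
    have hxi₁ : x (n₁ l) ≤ x i := hG.x_mono hi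
    have hxi₂ : x i ≤ x (n₂ l) := hG.x_mono hi'
    have hxa : x a ≤ x k := hG.x_mono hak
    have hxb : x k ≤ x b := hG.x_mono hkb
    rcases le_total i k with hik | hik
    · have hc := H.concave hG.lt_succ hp.nonneg hQ le_rfl (hn₁.trans hi) hik hkb
      have hua := hpos a hab
      have hxik : x i ≤ x k := hG.x_mono hik
      rw [huk] at hc
      have h1 : 0 ≤ (x k - x i) * u a := mul_nonneg (by linarith) hua.le
      have h2 : (x k - x a) * u i ≤ p.L * u i :=
        mul_le_mul_of_nonneg_right (by linarith) hui.le
      have h3 : p.ε * ζ ≤ (x i - x a) * ζ := mul_le_mul_of_nonneg_right (by linarith) hζpos.le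
      nlinarith
    · have hc := H.concave hG.lt_succ hp.nonneg hQ hak hik (hi'.trans hn₂) le_rfl
      have hub := hpos b le_rfl
      have hxik : x k ≤ x i := hG.x_mono hik
      rw [huk] at hc
      have h1 : 0 ≤ (x i - x k) * u b := mul_nonneg (by linarith) hub.le
      have h2 : (x b - x k) * u i ≤ p.L * u i :=
        mul_le_mul_of_nonneg_right (by linarith) hui.le
      have h3 : p.ε * ζ ≤ (x b - x i) * ζ := mul_le_mul_of_nonneg_right (by linarith) hζpos.le
      nlinarith
  have hv := H.vel_le hn₁₂ (fun i hi hi' => hQ i (by omega) (by omega)) fun i hi hi' =>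
    hp.c₁_le (u (i + 1)) (tent _ (by omega) (by omega))
      ((hu _ (by omega) (by omega)).trans hζ')
  have h1 := H.le_pos hG.lt_succ hn₁ (c := v (n₁ l))
    fun i hi hi' => H.vel_anti hp.nonneg hQ hi hi'.le (by omega)
  have h2 := H.pos_le hG.lt_succ hn₂ (c := v (n₂ l))
    fun i hi hi' => H.vel_anti hp.nonneg hQ (by omega) hi (by omega)
  have hua := hpos a hab
  have hub := hpos b le_rfl
  have hu₁ := hu (n₁ l) hn₁ (by omega)
  have hu₂ := hu (n₂ l) (by omega) hn₂
  have hdiv : ζ / p.ε * p.ε = ζ := div_mul_cancel₀ _ hε.ne'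
  have hdpos : 0 < ζ / p.ε := by positivity
  have h3 : v (n₁ l) ≤ ζ / p.ε := by
    by_contra! hc
    nlinarith
  have h4 : -(ζ / p.ε) ≤ v (n₂ l) := by
    by_contra! hc
    nlinarith
  have h5 : p.c₁ * p.LB ≤ p.c₁ * (Q (n₂ l) - Q (n₁ l)) :=
    mul_le_mul_of_nonneg_left (hG.mass_core l) hp.c₁_pos.le
  have h6 : ζ / p.ε ≤ p.z₃ / p.ε := by gcongr
  have h7 := hp.lt_LB
  rw [mul_div_assoc] at h7
  linarith

/-- A trajectory entering a block of nonpositive weight high enough stays positive and leaves it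
with a large slope. -/
lemma slope_le_vel_of_minus (hp : p.Nonlinearity h) (hG : p.Grid x Q K n₁ n₂)
    (H : IsKick x Q h u v) {l : ℕ} {ζ : ℝ} (hζ : p.z₀ ≤ ζ) (hζ' : ζ ≤ p.z₄)
    (hu : ζ / 2 ≤ u (K (2 * l))) (hv : -(ζ / (4 * p.L)) ≤ v (K (2 * l))) :
    (∀ i, K (2 * l) ≤ i → i ≤ K (2 * l + 1) → 0 < u i) ∧ p.slope ≤ v (K (2 * l + 1)) := by
  have hQ : ∀ i, K (2 * l) ≤ i → i < K (2 * l + 1) → Q (i + 1) ≤ Q i := hG.minus l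
  have hL := hG.len_minus l
  have hM := hG.mass_minus l
  set a := K (2 * l)
  set b := K (2 * l + 1)
  have hab : a ≤ b := hG.K_mono (by omega)
  have hLpos := hp.L_pos
  have hz₀ := hp.z₀_pos
  have hζpos := hz₀.trans_le hζ
  have hpos : ∀ i, a ≤ i → i ≤ b → p.z₀ / 4 ≤ u i := by
    intro i hi hi'
    have h1 := H.le_pos hG.lt_succ hi (c := -(ζ / (4 * p.L)))
      fun k hk hk' => hv.trans (H.vel_mono hp.nonneg hQ le_rfl hk (by omega))
    have h2 : ζ / (4 * p.L) * (x i - x a) ≤ ζ / (4 * p.L) * p.L :=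
      mul_le_mul_of_nonneg_left (by linarith [hG.x_mono hi']) (by positivity)
    have h3 : ζ / (4 * p.L) * p.L = ζ / 4 := by field_simp
    linarith
  refine ⟨fun i hi hi' => by linarith [hpos i hi hi'], ?_⟩
  have h1 := H.le_vel_of_antitone hab hQ fun i hi hi' => hp.c_le _ (hpos (i + 1) (by omega) hi')
  have h2 := mul_le_mul_of_nonneg_left hM hp.c_pos.le
  have h3 : ζ / (4 * p.L) ≤ p.z₄ / (4 * p.L) := by gcongr
  linarith [hp.le_MB, hp.le_slope]

/-- A trajectory which leaves a block of nonpositive weight with nonpositive slope is small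
there. -/
lemma pos_lt_of_vel_nonpos (hp : p.Nonlinearity h) (hG : p.Grid x Q K n₁ n₂)
    (H : IsKick x Q h u v) {l : ℕ} (hv : -p.slope ≤ v (K (2 * l)))
    (hv' : v (K (2 * l + 1)) ≤ 0) : u (K (2 * l + 1)) < p.z₀ := by
  by_contra! hu
  have hQ : ∀ i, K (2 * l) ≤ i → i < K (2 * l + 1) → Q (i + 1) ≤ Q i := hG.minus l
  have hM := hG.mass_minus l
  set a := K (2 * l)
  set b := K (2 * l + 1)
  have hab : a ≤ b := hG.K_mono (by omega)
  have hz₀ := hp.z₀_pos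
  have hpos : ∀ i, a ≤ i → i ≤ b → p.z₀ / 4 ≤ u i := by
    intro i hi hi'
    have h1 := H.pos_le hG.lt_succ hi' (c := 0)
      fun k hk hk' => (H.vel_mono hp.nonneg hQ (by omega) hk'.le le_rfl).trans hv'
    linarith
  have h1 := H.le_vel_of_antitone hab hQ fun i hi hi' => hp.c_le _ (hpos (i + 1) (by omega) hi')
  have h2 := mul_le_mul_of_nonneg_left hM hp.c_pos.le
  linarith [hp.le_MB, hp.slope_pos]

/-- If the maximum on a block of nonnegative weight is one of the thresholds `z₀`, `z₁`, `z₄`, the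
trajectory stays positive and leaves the next block of nonpositive weight with a large slope. -/
lemma slope_le_vel_of_max (hp : p.Nonlinearity h) (hG : p.Grid x Q K n₁ n₂) (H : IsKick x Q h u v)
    {l : ℕ} {ζ : ℝ} (hζ : p.z₀ ≤ ζ) (hζ' : ζ ≤ p.z₄)
    (hle : ∀ s ≤ ζ, h s ≤ ζ / (4 * p.L * p.LA)) (hpos : ∀ k ≤ K (2 * l + 1), 0 < u k)
    (hv : -p.slope ≤ v (K (2 * l)))
    (hu : ∀ i, K (2 * l + 1) ≤ i → i ≤ K (2 * l + 2) → u i ≤ ζ)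
    (hmax : ∃ k, K (2 * l + 1) ≤ k ∧ k ≤ K (2 * l + 2) ∧ u k = ζ) :
    (∀ k ≤ K (2 * l + 3), 0 < u k) ∧ p.slope ≤ v (K (2 * l + 3)) := by
  obtain ⟨k, hak, hkb, huk⟩ := hmax
  have hQ : ∀ i, K (2 * l + 1) ≤ i → i < K (2 * l + 2) → Q i ≤ Q (i + 1) := hG.plus l
  have hab : K (2 * l + 1) ≤ K (2 * l + 2) := hG.K_mono (by omega)
  have hL := hG.len_plus l
  have hLpos := hp.L_pos
  have hLA := hp.LA_pos
  have hζpos := hp.z₀_pos.trans_le hζ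
  have hva : 0 < v (K (2 * l + 1)) := by
    by_contra! hc
    have h1 := pos_lt_of_vel_nonpos hp hG H hv hc
    have h2 := H.pos_le hG.lt_succ hak (c := 0)
      fun i hi hi' => (H.vel_anti hp.nonneg hQ le_rfl hi (by omega)).trans hc
    linarith
  have hvel : ∀ i, K (2 * l + 1) ≤ i → i ≤ K (2 * l + 2) → -(ζ / (4 * p.L)) ≤ v i := by
    intro i hi hi'
    have h1 := H.le_vel hi (fun j hj hj' => hQ j hj (by omega))
      fun j hj hj' => hle _ (hu (j + 1) (by omega) (by omega))
    have h2 : ζ / (4 * p.L * p.LA) * (Q i - Q (K (2 * l + 1))) ≤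
        ζ / (4 * p.L * p.LA) * p.LA :=
      mul_le_mul_of_nonneg_left (by linarith [hG.mass_plus l, hG.Q_mono hi hi' le_rfl])
        (by positivity)
    rw [hp.div_mul_LA] at h2
    linarith
  have hub : ζ / 2 ≤ u (K (2 * l + 2)) := by
    have h1 := H.le_pos hG.lt_succ hkb (c := -(ζ / (4 * p.L)))
      fun i hi hi' => hvel i (by omega) hi'.le
    have h2 : ζ / (4 * p.L) * (x (K (2 * l + 2)) - x k) ≤ ζ / (4 * p.L) * p.L :=
      mul_le_mul_of_nonneg_left (by linarith [hG.x_mono hak]) (by positivity)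
    have h3 : ζ / (4 * p.L) * p.L = ζ / 4 := by field_simp
    linarith
  have hplus : ∀ i, K (2 * l + 1) ≤ i → i ≤ K (2 * l + 2) → 0 < u i := by
    intro i hi hi'
    rcases le_total 0 (v i) with hvi | hvi
    · have h1 := H.le_pos hG.lt_succ hi (c := 0)
        fun j hj hj' => hvi.trans (H.vel_anti hp.nonneg hQ hj hj'.le hi')
      linarith [hpos _ (le_refl (K (2 * l + 1)))]
    · have h1 := H.pos_le hG.lt_succ hi' (c := 0)
        fun j hj hj' => (H.vel_anti hp.nonneg hQ hi hj hj'.le).trans hvi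
      linarith
  obtain ⟨h1, h2⟩ := slope_le_vel_of_minus hp hG H (l := l + 1) hζ hζ' hub (hvel _ hab le_rfl)
  refine ⟨fun i hi => ?_, h2⟩
  rcases le_total i (K (2 * l + 1)) with h3 | h3
  · exact hpos i h3
  rcases le_total i (K (2 * l + 2)) with h4 | h4
  · exact hplus i h3 h4
  · exact h1 i h4 hi

/-- A trajectory entering a block of nonnegative weight with large slope reaches `z₄`. -/
lemma exists_z₄_le (hp : p.Nonlinearity h) (hG : p.Grid x Q K n₁ n₂) (H : IsKick x Q h u v) {l : ℕ}
    (hu : 0 ≤ u (K (2 * l + 1))) (hv : p.slope ≤ v (K (2 * l + 1))) :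
    p.z₄ ≤ u (K (2 * l + 2)) := by
  have hQ : ∀ i, K (2 * l + 1) ≤ i → i < K (2 * l + 2) → Q i ≤ Q (i + 1) := hG.plus l
  have hab : K (2 * l + 1) ≤ K (2 * l + 2) := hG.K_mono (by omega)
  have hlen := hG.le_len_plus l
  have hz := hp.z₄_pos
  have hl₀ := hp.l₀_pos
  have hLpos := hp.L_pos
  have hLA := hp.LA_pos
  have hvel : ∀ i, K (2 * l + 1) ≤ i → i < K (2 * l + 2) → p.z₄ / p.l₀ ≤ v i := by
    intro i hi hi'
    have h1 := H.le_vel hi (fun j hj hj' => hQ j hj (by omega))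
      fun j hj hj' => hp.le_z₄ (u (j + 1))
    have h2 : p.z₄ / (4 * p.L * p.LA) * (Q i - Q (K (2 * l + 1))) ≤
        p.z₄ / (4 * p.L * p.LA) * p.LA :=
      mul_le_mul_of_nonneg_left (by linarith [hG.mass_plus l, hG.Q_mono hi hi'.le le_rfl])
        (by positivity)
    rw [hp.div_mul_LA] at h2
    rw [slope] at hv
    linarith
  have h1 := H.le_pos hG.lt_succ hab hvel
  have h2 : p.z₄ / p.l₀ * p.l₀ ≤ p.z₄ / p.l₀ * (x (K (2 * l + 2)) - x (K (2 * l + 1))) :=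
    mul_le_mul_of_nonneg_left hlen (by positivity)
  rw [div_mul_cancel₀ _ hl₀.ne'] at h2
  linarith

end ShootingConstants

lemma exists_crossing {f : ℝ → ℝ} {a b c d : ℝ} (hab : a ≤ b) (hf : Continuous f) (hcd : c < d)
    (ha : f a ≤ c) (hb : d ≤ f b) :
    ∃ α β, a ≤ α ∧ α ≤ β ∧ β ≤ b ∧ f α = c ∧ f β = d ∧ ∀ s ∈ Icc α β, f s ∈ Icc c d := by
  obtain ⟨β, ⟨hβ, hβd⟩, hleast⟩ : ∃ β, IsLeast (Icc a b ∩ f ⁻¹' {d}) β := by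
    refine (isCompact_Icc.inter_right (isClosed_singleton.preimage hf)).exists_isLeast ?_
    obtain ⟨s, hs, hsd⟩ := intermediate_value_Icc hab hf.continuousOn ⟨ha.trans hcd.le, hb⟩
    exact ⟨s, hs, hsd⟩
  obtain ⟨α, ⟨hα, hαc⟩, hgreatest⟩ : ∃ α, IsGreatest (Icc a β ∩ f ⁻¹' {c}) α := by
    refine (isCompact_Icc.inter_right (isClosed_singleton.preimage hf)).exists_isGreatest ?_
    obtain ⟨s, hs, hsd⟩ := intermediate_value_Icc hβ.1 hf.continuousOn
      ⟨ha, hcd.le.trans (le_of_eq hβd.symm)⟩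
    exact ⟨s, hs, hsd⟩
  refine ⟨α, β, hα.1, hα.2, hβ.2, hαc, hβd, fun s hs => ⟨?_, ?_⟩⟩
  · by_contra! hlt
    obtain ⟨s', hs', hsd⟩ := intermediate_value_Icc hs.2 hf.continuousOn
      ⟨hlt.le, hcd.le.trans (le_of_eq hβd.symm)⟩
    have h1 := hgreatest ⟨⟨hα.1.trans (hs.1.trans hs'.1), hs'.2⟩, hsd⟩
    have h2 : s = s' := le_antisymm hs'.1 (h1.trans hs.1)
    rw [h2, hsd] at hlt
    exact lt_irrefl _ hlt
  · by_contra! hlt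
    obtain ⟨s', hs', hsd⟩ := intermediate_value_Icc (hα.1.trans hs.1) hf.continuousOn
      ⟨ha.trans hcd.le, hlt.le⟩
    have h1 := hleast ⟨⟨hs'.1, hs'.2.trans (hs.2.trans hβ.2)⟩, hsd⟩
    have h2 : s = s' := le_antisymm (hs.2.trans h1) hs'.2
    rw [h2, hsd] at hlt
    exact lt_irrefl _ hlt

lemma exists_last_zero {f : ℝ → ℝ} {a b : ℝ} (hab : a ≤ b) (hf : Continuous f) (ha : f a ≤ 0)
    (hb : 0 < f b) : ∃ α ∈ Ico a b, f α = 0 ∧ ∀ s ∈ Ioc α b, 0 < f s := by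
  obtain ⟨α, ⟨hα, hα0⟩, hgreatest⟩ : ∃ α, IsGreatest (Icc a b ∩ f ⁻¹' {0}) α := by
    refine (isCompact_Icc.inter_right (isClosed_singleton.preimage hf)).exists_isGreatest ?_
    obtain ⟨s, hs, hsd⟩ := intermediate_value_Icc hab hf.continuousOn ⟨ha, hb.le⟩
    exact ⟨s, hs, hsd⟩
  have hαb : α ≠ b := by
    rintro rfl
    exact hb.ne' hα0
  refine ⟨α, ⟨hα.1, lt_of_le_of_ne hα.2 hαb⟩, hα0, fun s hs => ?_⟩
  by_contra! hle
  obtain ⟨s', hs', hsd⟩ := intermediate_value_Icc hs.2 hf.continuousOn ⟨hle, hb.le⟩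
  have h1 := hgreatest ⟨⟨hα.1.trans (hs.1.le.trans hs'.1), hs'.2⟩, hsd⟩
  linarith [hs.1, hs'.1]

/-- The trajectory with given initial position and slope. -/
noncomputable def kickSeq (x Q : ℕ → ℝ) (h : ℝ → ℝ) (u₀ v₀ : ℝ) : ℕ → ℝ × ℝ
  | 0 => (u₀, v₀)
  | i + 1 =>
    ((kickSeq x Q h u₀ v₀ i).1 + (x (i + 1) - x i) * (kickSeq x Q h u₀ v₀ i).2,
      (kickSeq x Q h u₀ v₀ i).2 - (Q (i + 1) - Q i) *
        h ((kickSeq x Q h u₀ v₀ i).1 + (x (i + 1) - x i) * (kickSeq x Q h u₀ v₀ i).2))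

lemma isKick_kickSeq (x Q : ℕ → ℝ) (h : ℝ → ℝ) (u₀ v₀ : ℝ) :
    IsKick x Q h (fun i => (kickSeq x Q h u₀ v₀ i).1) (fun i => (kickSeq x Q h u₀ v₀ i).2) :=
  ⟨fun _ => rfl, fun _ => rfl⟩

lemma continuous_kickSeq (x Q : ℕ → ℝ) {h : ℝ → ℝ} (hh : Continuous h) {φ : ℝ → ℝ}
    (hφ : Continuous φ) (v₀ : ℝ) (i : ℕ) : Continuous fun s => kickSeq x Q h (φ s) v₀ i := by
  induction i with
  | zero => exact hφ.prodMk continuous_const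
  | succ i ih =>
    simp only [kickSeq]
    fun_prop

namespace ShootingConstants

variable {p : ShootingConstants} {x Q : ℕ → ℝ} {h : ℝ → ℝ} {K n₁ n₂ : ℕ → ℕ}

/-- Lower threshold for the maximum prescribed by a symbol. -/
def lower (p : ShootingConstants) : Fin 3 → ℝ := ![0, p.z₁, p.z₃]

/-- Upper threshold for the maximum prescribed by a symbol. -/
def upper (p : ShootingConstants) : Fin 3 → ℝ := ![p.z₀, p.z₂, p.z₄]

lemma Nonlinearity.lower_nonneg (hp : p.Nonlinearity h) (k : Fin 3) : 0 ≤ p.lower k := by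
  have := hp.z₀_pos
  have := hp.z₀_lt
  have := hp.z₁_lt
  have := hp.z₂_lt
  fin_cases k <;> simp [lower] <;> linarith

lemma Nonlinearity.lower_lt_upper (hp : p.Nonlinearity h) (k : Fin 3) :
    p.lower k < p.upper k := by
  have := hp.z₀_pos
  have := hp.z₁_lt
  have := hp.z₃_lt
  fin_cases k <;> simp [lower, upper] <;> linarith

lemma Nonlinearity.upper_le (hp : p.Nonlinearity h) (k : Fin 3) : p.upper k ≤ p.z₄ := by
  have := hp.z₀_lt
  have := hp.z₁_lt
  have := hp.z₂_lt
  have := hp.z₃_lt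
  fin_cases k <;> simp [upper] <;> linarith

/-- The maximum of `u` on the `l`-th block of nonnegative weight is as prescribed by `k`. -/
def Codes (p : ShootingConstants) (K : ℕ → ℕ) (u : ℕ → ℝ) (l : ℕ) (k : Fin 3) : Prop :=
  (∀ i, K (2 * l + 1) ≤ i → i ≤ K (2 * l + 2) → u i ≤ p.upper k) ∧
    ∃ i, K (2 * l + 1) ≤ i ∧ i ≤ K (2 * l + 2) ∧ p.lower k ≤ u i

lemma neg_slope_le_vel (hp : p.Nonlinearity h) (hG : p.Grid x Q K n₁ n₂) {u v : ℕ → ℝ}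
    (H : IsKick x Q h u v) (hv : v 0 = -(p.z₄ / (4 * p.L))) (S : ℕ → Fin 3) {l : ℕ}
    (hS : ∀ j < l, p.Codes K u j (S j)) (hu : ∀ k ≤ K (2 * l), 0 ≤ u k) :
    -p.slope ≤ v (K (2 * l)) := by
  cases l with
  | zero => rw [mul_zero, hG.K_zero, hv]; linarith [hp.le_slope]
  | succ l =>
    have h1 := abs_vel_le hp hG H (l := l)
      (fun i hi hi' => ⟨hu i hi', ((hS l (by omega)).1 i hi hi').trans (hp.upper_le _)⟩)
      (hG.K_mono (by omega)) le_rfl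
    exact (abs_le.1 h1).1

/-- Shooting: a path of initial positions whose trajectories follow the prescribed code on the
first `l` blocks, with one end that has vanished and the other end that leaves with a large
slope. -/
lemma exists_path (hp : p.Nonlinearity h) (hG : p.Grid x Q K n₁ n₂) (S : ℕ → Fin 3) (l : ℕ) :
    ∃ φ : ℝ → ℝ, Continuous φ ∧
      (∀ s ∈ Icc (0 : ℝ) 1, ∀ j < l,
        p.Codes K (fun i => (kickSeq x Q h (φ s) (-(p.z₄ / (4 * p.L))) i).1) j (S j)) ∧
      (∃ k ≤ K (2 * l + 1), (kickSeq x Q h (φ 0) (-(p.z₄ / (4 * p.L))) k).1 ≤ 0) ∧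
      (∀ k ≤ K (2 * l + 1), 0 < (kickSeq x Q h (φ 1) (-(p.z₄ / (4 * p.L))) k).1) ∧
      p.slope ≤ (kickSeq x Q h (φ 1) (-(p.z₄ / (4 * p.L))) (K (2 * l + 1))).2 := by
  have hz₄ := hp.z₄_pos
  have hz₀ := hp.z₀_pos
  have h01 := hp.z₀_lt
  have h12 := hp.z₁_lt
  have h23 := hp.z₂_lt
  have h34 := hp.z₃_lt
  have hLpos := hp.L_pos
  induction l with
  | zero =>
    refine ⟨fun s => s * p.z₄, by fun_prop, fun s _ j hj => absurd hj (by omega),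
      ⟨0, by omega, by simp [kickSeq]⟩, ?_⟩
    have h1 := slope_le_vel_of_minus hp hG
      (isKick_kickSeq x Q h (1 * p.z₄) (-(p.z₄ / (4 * p.L)))) (l := 0) (ζ := p.z₄)
      (by linarith) le_rfl (by simp only [mul_zero, hG.K_zero, kickSeq]; linarith)
      (by simp only [mul_zero, hG.K_zero, kickSeq]; exact le_rfl)
    refine ⟨fun k hk => h1.1 k ?_ hk, h1.2⟩
    simp only [mul_zero, hG.K_zero, Nat.zero_le]
  | succ l ih =>
    obtain ⟨φ, hφ, hcode, ⟨k₀, hk₀, hk₀'⟩, hpos1, hv1⟩ := ih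
    set v₀ := -(p.z₄ / (4 * p.L)) with hv₀
    have hv₀neg : v₀ < 0 := by rw [hv₀, neg_lt_zero]; positivity
    set U : ℝ → ℕ → ℝ := fun s i => (kickSeq x Q h (φ s) v₀ i).1 with hU
    set V : ℝ → ℕ → ℝ := fun s i => (kickSeq x Q h (φ s) v₀ i).2 with hV
    have hkick : ∀ s, IsKick x Q h (U s) (V s) := fun s => isKick_kickSeq x Q h (φ s) v₀
    have hUc : ∀ i, Continuous fun s => U s i :=
      fun i => (continuous_kickSeq x Q hp.cont hφ v₀ i).fst
    have hne : (Finset.range (K (2 * l + 1) + 1)).Nonempty := ⟨0, by simp⟩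
    have hab : K (2 * l + 1) ≤ K (2 * l + 2) := hG.K_mono (by omega)
    have hne' : (Finset.Icc (K (2 * l + 1)) (K (2 * l + 2))).Nonempty :=
      ⟨_, Finset.left_mem_Icc.2 hab⟩
    set F : ℝ → ℝ := fun s => (Finset.range (K (2 * l + 1) + 1)).inf' hne fun k => U s k
    set M : ℝ → ℝ := fun s =>
      (Finset.Icc (K (2 * l + 1)) (K (2 * l + 2))).sup' hne' fun k => U s k
    have hFc : Continuous F := Continuous.finset_inf'_apply hne fun i _ => hUc i
    have hMc : Continuous M := Continuous.finset_sup'_apply hne' fun i _ => hUc i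
    have hMle : ∀ s i, K (2 * l + 1) ≤ i → i ≤ K (2 * l + 2) → U s i ≤ M s := fun s i hi hi' =>
      Finset.le_sup' (fun k => U s k) (Finset.mem_Icc.2 ⟨hi, hi'⟩)
    have hMex : ∀ s, ∃ i, K (2 * l + 1) ≤ i ∧ i ≤ K (2 * l + 2) ∧ U s i = M s := fun s => by
      obtain ⟨i, hi, hi'⟩ := Finset.exists_mem_eq_sup' hne' fun k => U s k
      exact ⟨i, (Finset.mem_Icc.1 hi).1, (Finset.mem_Icc.1 hi).2, hi'.symm⟩
    obtain ⟨α, hα, hFα, hFpos⟩ := exists_last_zero zero_le_one hFc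
      ((Finset.inf'_le (fun k => U 0 k) (Finset.mem_range.2 (by omega : k₀ < _))).trans hk₀')
      ((Finset.lt_inf'_iff hne).2 fun k hk => hpos1 k (by have := Finset.mem_range.1 hk; omega))
    have hnonneg : ∀ k ≤ K (2 * l + 1), 0 ≤ U α k := fun k hk =>
      hFα.symm.le.trans (Finset.inf'_le (fun k => U α k) (Finset.mem_range.2 (by omega)))
    have hpos : ∀ s ∈ Ioc α 1, ∀ k ≤ K (2 * l + 1), 0 < U s k := fun s hs k hk =>
      (hFpos s hs).trans_le (Finset.inf'_le (fun k => U s k) (Finset.mem_range.2 (by omega)))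
    have hMα : M α ≤ 0 := by
      obtain ⟨k, hk, hk'⟩ := Finset.exists_mem_eq_inf' hne fun k => U α k
      have hk'' : U α k = 0 := hk'.symm.trans hFα
      obtain ⟨i, hi, -, hi'⟩ := hMex α
      rw [← hi']
      exact (hkick α).pos_le_zero_of_eq_zero hG.lt_succ hp.eq_zero hv₀neg hnonneg
        (by have := Finset.mem_range.1 hk; omega) hk'' i hi
    have hM1 : p.z₄ ≤ M 1 :=
      (exists_z₄_le hp hG (hkick 1) (hpos1 _ le_rfl).le hv1).trans (hMle 1 _ hab le_rfl)
    obtain ⟨β, γ, hαβ, hβγ, hγ, hMβ, hMγ, hM⟩ := exists_crossing hα.2.le hMc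
      (hp.lower_lt_upper (S l)) (hMα.trans (hp.lower_nonneg _)) ((hp.upper_le _).trans hM1)
    have hcode' : ∀ s ∈ Icc β γ, ∀ j < l + 1, p.Codes K (U s) j (S j) := by
      intro s hs j hj
      rcases Nat.lt_succ_iff_lt_or_eq.1 hj with hj' | rfl
      · exact hcode s ⟨hα.1.trans (hαβ.trans hs.1), hs.2.trans hγ⟩ j hj'
      · refine ⟨fun i hi hi' => (hMle s i hi hi').trans (hM s hs).2, ?_⟩
        obtain ⟨i, hi, hi', hi''⟩ := hMex s
        exact ⟨i, hi, hi', hi''.symm ▸ (hM s hs).1⟩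
    have hhit : ∀ s, p.z₂ ≤ M s → M s ≤ p.z₃ → ∃ k ≤ K (2 * (l + 1) + 1), U s k ≤ 0 := by
      intro s h1 h2
      obtain ⟨k, hk, hk'⟩ := exists_neg_of_max hp hG (hkick s) h1 h2 (hMle s) (hMex s)
      exact ⟨k, hk.trans (hG.K_mono (by omega)), hk'⟩
    have hexp : ∀ s ∈ Icc β γ, ∀ ζ, M s = ζ → p.z₀ ≤ ζ → ζ ≤ p.z₄ →
        (∀ y ≤ ζ, h y ≤ ζ / (4 * p.L * p.LA)) →
        (∀ k ≤ K (2 * (l + 1) + 1), 0 < U s k) ∧ p.slope ≤ V s (K (2 * (l + 1) + 1)) := by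
      intro s hs ζ hMs h1 h2 h3
      have hs' : s ∈ Ioc α 1 := by
        refine ⟨lt_of_le_of_ne (hαβ.trans hs.1) ?_, hs.2.trans hγ⟩
        rintro rfl
        linarith
      refine slope_le_vel_of_max hp hG (hkick s) h1 h2 h3 (hpos s hs') ?_
        (fun i hi hi' => (hMle s i hi hi').trans hMs.le) ?_
      · exact neg_slope_le_vel hp hG (hkick s) rfl S
          (hcode s ⟨hα.1.trans hs'.1.le, hs'.2⟩)
          fun k hk => (hpos s hs' k (hk.trans (hG.K_mono (by omega)))).le
      · obtain ⟨i, hi, hi', hi''⟩ := hMex s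
        exact ⟨i, hi, hi', hi''.trans hMs⟩
    obtain ⟨e₀, he₀, e₁, he₁, hit, exits⟩ : ∃ e₀ ∈ Icc β γ, ∃ e₁ ∈ Icc β γ,
        (∃ k ≤ K (2 * (l + 1) + 1), U e₀ k ≤ 0) ∧
        (∀ k ≤ K (2 * (l + 1) + 1), 0 < U e₁ k) ∧ p.slope ≤ V e₁ (K (2 * (l + 1) + 1)) := by
      have hβ : β ∈ Icc β γ := left_mem_Icc.2 hβγ
      have hγ' : γ ∈ Icc β γ := right_mem_Icc.2 hβγ
      have h3 : ∀ k : Fin 3, k = 0 ∨ k = 1 ∨ k = 2 := by decide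
      rcases h3 (S l) with hS | hS | hS <;> rw [hS] at hMβ hMγ <;>
        simp only [lower, upper, Matrix.cons_val] at hMβ hMγ
      · refine ⟨β, hβ, γ, hγ', ⟨K (2 * l + 1), hG.K_mono (by omega), ?_⟩,
          hexp γ hγ' _ hMγ le_rfl (by linarith) hp.le_z₀⟩
        exact (hMle β _ le_rfl hab).trans hMβ.le
      · exact ⟨γ, hγ', β, hβ, hhit γ (by linarith) (by linarith),
          hexp β hβ _ hMβ (by linarith) (by linarith) hp.le_z₁⟩
      · exact ⟨β, hβ, γ, hγ', hhit β (by linarith) (by linarith),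
          hexp γ hγ' _ hMγ (by linarith) (by linarith) fun s _ => hp.le_z₄ s⟩
    refine ⟨fun s => φ (e₀ + s * (e₁ - e₀)), by fun_prop, fun s hs => ?_, ?_, ?_⟩
    · refine hcode' _ ?_
      have := (convex_Icc β γ).add_smul_sub_mem he₀ he₁ hs
      simpa using this
    · simpa using hit
    · simpa using exits

/-- A trajectory which follows the prescribed code on the first `l` blocks, with bounds. -/
lemma exists_kick_codes (hp : p.Nonlinearity h) (hG : p.Grid x Q K n₁ n₂) (S : ℕ → Fin 3) {l : ℕ}
    (hl : 0 < l) :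
    ∃ u v : ℕ → ℝ, IsKick x Q h u v ∧ (∀ j < l, p.Codes K u j (S j)) ∧
      ∀ i, K 1 ≤ i → i ≤ K (2 * l) → u i ∈ Icc 0 p.z₄ ∧ |v i| ≤ p.slope := by
  obtain ⟨φ, -, hcode, -, hpos, -⟩ := exists_path hp hG S l
  set u : ℕ → ℝ := fun i => (kickSeq x Q h (φ 1) (-(p.z₄ / (4 * p.L))) i).1
  set v : ℕ → ℝ := fun i => (kickSeq x Q h (φ 1) (-(p.z₄ / (4 * p.L))) i).2
  have H : IsKick x Q h u v := isKick_kickSeq x Q h _ _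
  have hC : ∀ j < l, p.Codes K u j (S j) := hcode 1 (by simp)
  refine ⟨u, v, H, hC, ?_⟩
  have hu0 : ∀ i ≤ K (2 * l), 0 ≤ u i := fun i hi => (hpos i (hi.trans (hG.K_mono (by omega)))).le
  have hplus : ∀ j < l, ∀ i, K (2 * j + 1) ≤ i → i ≤ K (2 * j + 2) →
      u i ∈ Icc 0 p.z₄ ∧ |v i| ≤ p.slope := by
    intro j hj i hi hi'
    have h1 : ∀ i, K (2 * j + 1) ≤ i → i ≤ K (2 * j + 2) → 0 ≤ u i ∧ u i ≤ p.z₄ :=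
      fun i hi hi' => ⟨hu0 i (hi'.trans (hG.K_mono (by omega))),
        ((hC j hj).1 i hi hi').trans (hp.upper_le _)⟩
    exact ⟨h1 i hi hi', abs_vel_le hp hG H h1 hi hi'⟩
  have key : ∀ n ≤ l, ∀ i, K 1 ≤ i → i ≤ K (2 * n) → u i ∈ Icc 0 p.z₄ ∧ |v i| ≤ p.slope := by
    intro n
    induction n with
    | zero =>
      intro _ i hi hi'
      have h0 : K (2 * 0) = 0 := hG.K_zero
      exact hplus 0 hl i hi (by omega)
    | succ n ih =>
      intro hn i hi hi'
      rcases le_total i (K (2 * n)) with h1 | h1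
      · exact ih (by omega) i hi h1
      rcases le_total (K (2 * n + 1)) i with h2 | h2
      · exact hplus n (by omega) i h2 hi'
      cases n with
      | zero => exact hplus 0 (by omega) i hi hi'
      | succ n =>
        have hQ : ∀ i, K (2 * (n + 1)) ≤ i → i < K (2 * (n + 1) + 1) → Q (i + 1) ≤ Q i :=
          hG.minus (n + 1)
        have ha := hplus n (by omega) (K (2 * n + 2)) (hG.K_mono (by omega)) le_rfl
        have hb := hplus (n + 1) (by omega) (K (2 * (n + 1) + 1)) le_rfl (hG.K_mono (by omega))
        rw [show 2 * n + 2 = 2 * (n + 1) by ring] at ha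
        have h3 := H.vel_mono hp.nonneg hQ le_rfl h1 h2
        have h4 := H.vel_mono hp.nonneg hQ h1 h2 le_rfl
        refine ⟨⟨hu0 i (hi'.trans (hG.K_mono (by omega))), ?_⟩,
          abs_le.2 ⟨(abs_le.1 ha.2).1.trans h3, h4.trans (abs_le.1 hb.2).2⟩⟩
        rcases le_total (v i) 0 with h5 | h5
        · have h6 := H.pos_le hG.lt_succ h1 (c := 0)
            fun k hk hk' => (H.vel_mono hp.nonneg hQ hk hk'.le h2).trans h5
          linarith [ha.1.2]
        · have h6 := H.le_pos hG.lt_succ h2 (c := 0)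
            fun k hk hk' => h5.trans (H.vel_mono hp.nonneg hQ h1 hk hk'.le)
          linarith [hb.1.2]
  exact key l le_rfl

end ShootingConstants

lemma tendsto_intervalIntegral_of_dominated {f : ℕ → ℝ → ℝ} {F B : ℝ → ℝ} {a b : ℕ → ℝ}
    {a₀ b₀ : ℝ} (hB : ∀ s t, IntervalIntegrable B volume s t)
    (hf : ∀ n, AEStronglyMeasurable (f n)) (hfB : ∀ n s, |f n s| ≤ B s)
    (hlim : ∀ s, Tendsto (fun n => f n s) atTop (𝓝 (F s))) (ha : Tendsto a atTop (𝓝 a₀))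
    (hb : Tendsto b atTop (𝓝 b₀)) :
    Tendsto (fun n => ∫ s in (a n)..(b n), f n s) atTop (𝓝 (∫ s in a₀..b₀, F s)) := by
  have hint : ∀ n s t, IntervalIntegrable (f n) volume s t := fun n s t =>
    (hB s t).mono_fun (hf n).restrict (Eventually.of_forall fun x => by
      simpa using (hfB n x).trans (le_abs_self _))
  have hmain : Tendsto (fun n => ∫ s in a₀..b₀, f n s) atTop (𝓝 (∫ s in a₀..b₀, F s)) :=
    intervalIntegral.tendsto_integral_filter_of_dominated_convergence B
      (Eventually.of_forall fun n => (hf n).restrict)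
      (Eventually.of_forall fun n => Eventually.of_forall fun s _ => hfB n s) (hB a₀ b₀)
      (Eventually.of_forall fun s _ => hlim s)
  have hsmall : ∀ (c : ℕ → ℝ) (c₀ : ℝ), Tendsto c atTop (𝓝 c₀) →
      Tendsto (fun n => ∫ s in c₀..(c n), f n s) atTop (𝓝 0) := by
    intro c c₀ hc
    have h1 : Tendsto (fun n => |∫ s in c₀..(c n), B s|) atTop (𝓝 0) := by
      have h2 := ((intervalIntegral.continuous_primitive hB c₀).tendsto c₀).comp hc
      simp only [intervalIntegral.integral_same] at h2
      simpa using h2.abs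
    refine squeeze_zero_norm (fun n => ?_) h1
    exact intervalIntegral.norm_integral_le_abs_of_norm_le
      (Eventually.of_forall fun s => hfB n s) (hB _ _)
  have h := (hmain.sub (hsmall a a₀ ha)).add (hsmall b b₀ hb)
  rw [sub_zero, add_zero] at h
  refine h.congr fun n => ?_
  have h1 := intervalIntegral.integral_add_adjacent_intervals (hint n a₀ (a n)) (hint n (a n) (b n))
  have h2 := intervalIntegral.integral_add_adjacent_intervals (hint n a₀ b₀) (hint n b₀ (b n))
  linarith

/-- Convergence of drift-kick trajectories on finer and finer grids to a solution of
`w'' + q(t) h(w) = 0`. -/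
theorem exists_subseq_tendsto_isSolR {q h : ℝ → ℝ} (hq : LocallyIntegrable q) (hh : Continuous h)
    {C R V : ℝ} (hC : ∀ s, |h s| ≤ C) {X u v : ℕ → ℤ → ℝ} {A E : ℕ → ℤ} {δ : ℕ → ℝ}
    (hX : ∀ n, StrictMono (X n)) (hXtop : ∀ n, Tendsto (X n) atTop atTop)
    (hXbot : ∀ n, Tendsto (X n) atBot atBot)
    (hδ : Tendsto δ atTop (𝓝 0)) (hXδ : ∀ n k, X n (k + 1) - X n k ≤ δ n)
    (hA : Tendsto (fun n => X n (A n)) atTop atBot) (hE : Tendsto (fun n => X n (E n)) atTop atTop)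
    (hu : ∀ n k, u n k ∈ Icc 0 R) (hv : ∀ n k, |v n k| ≤ V)
    (hdrift : ∀ n k, A n ≤ k → k < E n → u n (k + 1) = u n k + (X n (k + 1) - X n k) * v n k)
    (hkick : ∀ n k, A n ≤ k → k < E n →
      v n (k + 1) = v n k - (∫ s in (X n k)..(X n (k + 1)), q s) * h (u n (k + 1))) :
    ∃ (ψ : ℕ → ℕ) (w z : ℝ → ℝ), StrictMono ψ ∧ IsSolR q h w z ∧ (∀ t, w t ∈ Icc 0 R) ∧
      ∀ (t : ℝ) (χ : ℕ → ℕ) (κ : ℕ → ℤ), Tendsto χ atTop atTop →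
        Tendsto (fun n => X (ψ (χ n)) (κ n)) atTop (𝓝 t) →
        Tendsto (fun n => u (ψ (χ n)) (κ n)) atTop (𝓝 (w t)) := by
  have hV : 0 ≤ V := (abs_nonneg _).trans (hv 0 0)
  have hex : ∀ n t, ∃ k, X n (k - 1) < t ∧ t ≤ X n k := by
    intro n t
    obtain ⟨b, hb⟩ := ((hXbot n).eventually_lt_atBot t).exists
    obtain ⟨k, hk, hk'⟩ := Int.exists_least_of_bdd (P := fun k => t ≤ X n k)
      ⟨b, fun z hz => le_of_not_gt fun hzb => absurd ((hX n).monotone hzb.le) (by linarith)⟩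
      ((hXtop n).eventually_ge_atTop t).exists
    refine ⟨k, lt_of_not_ge fun hc => ?_, hk⟩
    have := hk' _ hc
    omega
  choose kk hkk₁ hkk₂ using hex
  have hqi : ∀ s t, IntervalIntegrable q volume s t := fun s t => (hq.integrableOn_isCompact isCompact_uIcc).intervalIntegrable
  have hkkeq : ∀ n k s, X n k < s → s ≤ X n (k + 1) → kk n s = k + 1 := by
    intro n k s h1 h2
    have h3 : k < kk n s := (hX n).lt_iff_lt.1 (h1.trans_le (hkk₂ n s))
    have h4 : kk n s - 1 < k + 1 := (hX n).lt_iff_lt.1 ((hkk₁ n s).trans_le h2)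
    omega
  have hkkmono : ∀ n, Monotone (kk n) := by
    intro n s t hst
    have h4 : kk n s - 1 < kk n t :=
      (hX n).lt_iff_lt.1 ((hkk₁ n s).trans_le (hst.trans (hkk₂ n t)))
    omega
  have hvalid : ∀ n t, X n (A n) < t → t ≤ X n (E n) → A n ≤ kk n t - 1 ∧ kk n t ≤ E n := by
    intro n t h1 h2
    have h3 : A n < kk n t := (hX n).lt_iff_lt.1 (h1.trans_le (hkk₂ n t))
    have h4 : kk n t - 1 < E n := (hX n).lt_iff_lt.1 ((hkk₁ n t).trans_le h2)
    omega
  have hvalid' : ∀ t, ∀ᶠ n in atTop, A n ≤ kk n t - 1 ∧ kk n t ≤ E n := fun t => by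
    filter_upwards [hA.eventually_lt_atBot t, hE.eventually_ge_atTop t] with n h1 h2
    exact hvalid n t h1 h2
  have hceil : ∀ t, Tendsto (fun n => X n (kk n t)) atTop (𝓝 t) := fun t => by
    refine tendsto_of_tendsto_of_tendsto_of_le_of_le (g := fun _ => t) (h := fun n => t + δ n)
      tendsto_const_nhds (by simpa using hδ.const_add t) (fun n => hkk₂ n t) fun n => ?_
    have h1 := hXδ n (kk n t - 1)
    rw [sub_add_cancel] at h1
    linarith [hkk₁ n t]
  have hfloor : ∀ t, Tendsto (fun n => X n (kk n t - 1)) atTop (𝓝 t) := fun t => by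
    refine tendsto_of_tendsto_of_tendsto_of_le_of_le (g := fun n => t - δ n) (h := fun _ => t)
      (by simpa using hδ.const_sub t) tendsto_const_nhds (fun n => ?_) fun n => (hkk₁ n t).le
    have h1 := hXδ n (kk n t - 1)
    rw [sub_add_cancel] at h1
    linarith [hkk₂ n t]
  have hlip : ∀ n k k', A n ≤ k → k ≤ E n → A n ≤ k' → k' ≤ E n →
      |u n k' - u n k| ≤ V * |X n k' - X n k| := by
    intro n
    have key : ∀ k k', A n ≤ k → k ≤ k' → k' ≤ E n →
        |u n k' - u n k| ≤ V * (X n k' - X n k) := by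
      intro k k' hk hkk' hk'
      induction k', hkk' using Int.leInduction with
      | base => simp
      | succ j hj ih =>
        have h1 := ih (by omega)
        have h2 := hdrift n j (by omega) (by omega)
        have h3 := sub_pos.2 (hX n (lt_add_one j))
        have h4 : |(X n (j + 1) - X n j) * v n j| ≤ (X n (j + 1) - X n j) * V := by
          rw [abs_mul, abs_of_pos h3]
          exact mul_le_mul_of_nonneg_left (hv n j) h3.le
        have h5 := abs_add_le (u n j - u n k) ((X n (j + 1) - X n j) * v n j)
        rw [h2, show u n j + (X n (j + 1) - X n j) * v n j - u n k =
          (u n j - u n k) + (X n (j + 1) - X n j) * v n j by ring]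
        linarith
    intro k k' h1 h2 h3 h4
    rcases le_total k k' with hle | hle
    · rw [abs_of_nonneg (sub_nonneg.2 ((hX n).monotone hle))]
      exact key k k' h1 hle h4
    · rw [abs_sub_comm, abs_sub_comm (X n k'),
        abs_of_nonneg (sub_nonneg.2 ((hX n).monotone hle))]
      exact key k' k h3 hle h2
  set û : ℕ → ℝ → ℝ := fun n t => u n (kk n t) with hû
  set w' : ℕ → ℝ → ℝ := fun n t => v n (kk n t - 1) with hw'
  have hûm : ∀ n, Measurable (û n) := fun n =>
    (Measurable.of_discrete (f := u n)).comp (hkkmono n).measurable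
  have hw'm : ∀ n, Measurable (w' n) := fun n =>
    (Measurable.of_discrete (f := fun k => v n (k - 1))).comp (hkkmono n).measurable
  have hfm : ∀ n, AEStronglyMeasurable fun s => q s * h (û n s) := fun n =>
    hq.aestronglyMeasurable.mul (hh.measurable.comp (hûm n)).aestronglyMeasurable
  have hBi : ∀ s t, IntervalIntegrable (fun s => |q s| * C) volume s t :=
    fun s t => (hqi s t).abs.mul_const C
  have hfB : ∀ n s, |q s * h (û n s)| ≤ |q s| * C := fun n s => by
    rw [abs_mul]
    exact mul_le_mul_of_nonneg_left (hC _) (abs_nonneg _)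
  have hfi : ∀ n s t, IntervalIntegrable (fun s => q s * h (û n s)) volume s t := fun n s t =>
    (hBi s t).mono_fun (hfm n).restrict (Eventually.of_forall fun x => by
      simpa only [Real.norm_eq_abs] using (hfB n x).trans (le_abs_self _))
  have hwi : ∀ n s t, IntervalIntegrable (w' n) volume s t := fun n s t =>
    (intervalIntegrable_const (c := V)).mono_fun (hw'm n).aestronglyMeasurable.restrict
      (Eventually.of_forall fun x => by
        simpa only [Real.norm_eq_abs] using (hv n _).trans (le_abs_self _))
  have hvint : ∀ n k k', A n ≤ k → k ≤ E n → A n ≤ k' → k' ≤ E n →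
      v n k' = v n k - ∫ s in (X n k)..(X n k'), q s * h (û n s) := by
    intro n
    have key : ∀ k k', A n ≤ k → k ≤ k' → k' ≤ E n →
        v n k' = v n k - ∫ s in (X n k)..(X n k'), q s * h (û n s) := by
      intro k k' hk hkk' hk'
      induction k', hkk' using Int.leInduction with
      | base => simp
      | succ j hj ih =>
        have hcell : ∫ s in (X n j)..(X n (j + 1)), q s * h (û n s) =
            (∫ s in (X n j)..(X n (j + 1)), q s) * h (u n (j + 1)) := by
          rw [← intervalIntegral.integral_mul_const]
          refine intervalIntegral.integral_congr_ae (Eventually.of_forall fun s hs => ?_)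
          rw [uIoc_of_le (hX n (lt_add_one j)).le] at hs
          simp only [hû, hkkeq n j s hs.1 hs.2]
        rw [hkick n j (by omega) (by omega), ih (by omega), ← hcell,
          ← intervalIntegral.integral_add_adjacent_intervals (hfi n (X n k) (X n j))
            (hfi n (X n j) (X n (j + 1)))]
        ring
    intro k k' h1 h2 h3 h4
    rcases le_total k k' with hle | hle
    · exact key k k' h1 hle h4
    · rw [intervalIntegral.integral_symm, key k' k h3 hle h2]
      ring
  have huint : ∀ n k k', A n ≤ k → k ≤ E n → A n ≤ k' → k' ≤ E n →
      u n k' = u n k + ∫ s in (X n k)..(X n k'), w' n s := by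
    intro n
    have key : ∀ k k', A n ≤ k → k ≤ k' → k' ≤ E n →
        u n k' = u n k + ∫ s in (X n k)..(X n k'), w' n s := by
      intro k k' hk hkk' hk'
      induction k', hkk' using Int.leInduction with
      | base => simp
      | succ j hj ih =>
        have hcell : ∫ s in (X n j)..(X n (j + 1)), w' n s =
            (X n (j + 1) - X n j) * v n j := by
          rw [← smul_eq_mul, ← intervalIntegral.integral_const]
          refine intervalIntegral.integral_congr_ae (Eventually.of_forall fun s hs => ?_)
          rw [uIoc_of_le (hX n (lt_add_one j)).le] at hs
          simp only [hw', hkkeq n j s hs.1 hs.2, add_sub_cancel_right]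
        rw [hdrift n j (by omega) (by omega), ih (by omega), ← hcell,
          ← intervalIntegral.integral_add_adjacent_intervals (hwi n (X n k) (X n j))
            (hwi n (X n j) (X n (j + 1)))]
        ring
    intro k k' h1 h2 h3 h4
    rcases le_total k k' with hle | hle
    · exact key k k' h1 hle h4
    · rw [intervalIntegral.integral_symm, key k' k h3 hle h2]
      ring
  -- extraction of a subsequence which converges at all rational times
  obtain ⟨lim, ψ, hψ, hlim⟩ := CompactSpace.tendsto_subseq (X := (ℚ → Icc 0 R) × Icc (-V) V)
    fun n => (fun r => ⟨û n r, hu n _⟩, ⟨w' n 0, abs_le.1 (hv n _)⟩)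
  rw [Prod.tendsto_iff] at hlim
  have hlimQ : ∀ r : ℚ, Tendsto (fun n => û (ψ n) r) atTop (𝓝 (lim.1 r : ℝ)) := fun r =>
    (continuous_subtype_val.tendsto _).comp ((tendsto_pi_nhds.1 hlim.1) r)
  have hlim0 : Tendsto (fun n => w' (ψ n) 0) atTop (𝓝 (lim.2 : ℝ)) :=
    (continuous_subtype_val.tendsto _).comp hlim.2
  have hψt := hψ.tendsto_atTop
  have hconv : ∀ t, ∃ y, Tendsto (fun n => û (ψ n) t) atTop (𝓝 y) := by
    intro t
    refine cauchySeq_tendsto_of_complete (Metric.cauchySeq_iff.2 fun ε hε => ?_)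
    obtain ⟨r, hr₁, hr₂⟩ := exists_rat_btwn (show t < t + ε / (8 * (V + 1)) by
      have : 0 < ε / (8 * (V + 1)) := by positivity
      linarith)
    have hgap : V * |t - r| < ε / 4 := by
      have h1 : |t - r| ≤ ε / (8 * (V + 1)) := by rw [abs_le]; constructor <;> linarith
      have h2 : V * |t - r| ≤ V * (ε / (8 * (V + 1))) := mul_le_mul_of_nonneg_left h1 hV
      have h3 : V * (ε / (8 * (V + 1))) < ε / 4 := by
        rw [← mul_div_assoc, div_lt_div_iff₀ (by positivity) (by norm_num)]
        nlinarith
      linarith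
    have hnear : ∀ᶠ n in atTop, |û n t - û n r| < ε / 4 := by
      have h1 : Tendsto (fun n => V * |X n (kk n t) - X n (kk n r)|) atTop (𝓝 (V * |t - r|)) :=
        (((hceil t).sub (hceil r)).abs).const_mul V
      filter_upwards [h1.eventually_lt_const hgap, hvalid' t, hvalid' r] with n h2 h3 h4
      exact (hlip n _ _ (by omega) h4.2 (by omega) h3.2).trans_lt h2
    obtain ⟨N₁, hN₁⟩ := eventually_atTop.1 (hψt.eventually hnear)
    obtain ⟨N₂, hN₂⟩ := Metric.cauchySeq_iff.1 (hlimQ r).cauchySeq (ε / 4) (by positivity)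
    refine ⟨max N₁ N₂, fun m hm n hn => ?_⟩
    have h1 := hN₁ m (le_of_max_le_left hm)
    have h2 := hN₁ n (le_of_max_le_left hn)
    have h3 := hN₂ m (le_of_max_le_right hm) n (le_of_max_le_right hn)
    rw [Real.dist_eq] at h3 ⊢
    rw [abs_lt] at h1 h2 h3 ⊢
    constructor <;> linarith
  choose w hw using hconv
  have hfloor' : ∀ t, Tendsto (fun n => X (ψ n) (kk (ψ n) t - 1)) atTop (𝓝 t) :=
    fun t => (hfloor t).comp hψt
  have hceil' : ∀ t, Tendsto (fun n => X (ψ n) (kk (ψ n) t)) atTop (𝓝 t) :=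
    fun t => (hceil t).comp hψt
  set z : ℝ → ℝ := fun t => lim.2 - ∫ s in (0 : ℝ)..t, q s * h (w s) with hz
  have hzlim : ∀ t, Tendsto (fun n => w' (ψ n) t) atTop (𝓝 (z t)) := by
    intro t
    have h1 := hlim0.sub (tendsto_intervalIntegral_of_dominated hBi (fun n => hfm (ψ n))
      (fun n s => hfB (ψ n) s)
      (fun s => ((hh.tendsto (w s)).comp (hw s)).const_mul (q s)) (hfloor' 0) (hfloor' t))
    refine h1.congr' ?_
    filter_upwards [hψt.eventually (hvalid' t), hψt.eventually (hvalid' 0)] with n h2 h3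
    exact (hvint (ψ n) _ _ h3.1 (by omega) h2.1 (by omega)).symm
  have hwint : ∀ t, w t = w 0 + ∫ s in (0 : ℝ)..t, z s := by
    intro t
    refine tendsto_nhds_unique (hw t) ?_
    have h1 := (hw 0).add (tendsto_intervalIntegral_of_dominated (B := fun _ => V)
      (fun _ _ => intervalIntegrable_const) (fun n => (hw'm (ψ n)).aestronglyMeasurable)
      (fun n s => hv (ψ n) _) hzlim (hceil' 0) (hceil' t))
    refine h1.congr' ?_
    filter_upwards [hψt.eventually (hvalid' t), hψt.eventually (hvalid' 0)] with n h2 h3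
    exact (huint (ψ n) _ _ (by omega) h3.2 (by omega) h2.2).symm
  have hwlip : ∀ s t, |w t - w s| ≤ V * |t - s| := by
    intro s t
    refine le_of_tendsto_of_tendsto ((hw t).sub (hw s)).abs
      (((hceil' t).sub (hceil' s)).abs.const_mul V) ?_
    filter_upwards [hψt.eventually (hvalid' t), hψt.eventually (hvalid' s)] with n h2 h3
    exact hlip (ψ n) _ _ (by omega) h3.2 (by omega) h2.2
  have hwcont : Continuous w := by
    have : LipschitzWith V.toNNReal w := LipschitzWith.of_dist_le_mul fun s t => by
      rw [Real.dist_eq, Real.dist_eq, Real.coe_toNNReal V hV]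
      exact hwlip t s
    exact this.continuous
  have hqw : ∀ s t, IntervalIntegrable (fun s => q s * h (w s)) volume s t := fun s t =>
    (hqi s t).mul_continuousOn (hh.comp hwcont).continuousOn
  have hzcont : Continuous z := continuous_const.sub (intervalIntegral.continuous_primitive hqw 0)
  refine ⟨ψ, w, z, hψ, ⟨fun t => ?_, fun t₀ t => ?_⟩, fun t => ?_, fun t χ κ hχ hκ => ?_⟩
  · have h1 := (intervalIntegral.integral_hasDerivAt_right (hzcont.intervalIntegrable 0 t)
      hzcont.stronglyMeasurable.stronglyMeasurableAtFilter hzcont.continuousAt).const_add (w 0)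
    exact h1.congr_of_eventuallyEq (Eventually.of_forall hwint)
  · have h1 := intervalIntegral.integral_add_adjacent_intervals (hqw 0 t₀) (hqw t₀ t)
    simp only [hz]
    linarith
  · exact isClosed_Icc.mem_of_tendsto (hw t) (Eventually.of_forall fun n => hu _ _)
  · have hψχ := hψt.comp hχ
    have h1 : Tendsto (fun n => u (ψ (χ n)) (κ n) - û (ψ (χ n)) t) atTop (𝓝 0) := by
      have h2 : Tendsto (fun n => V * |X (ψ (χ n)) (κ n) - X (ψ (χ n)) (kk (ψ (χ n)) t)|) atTop
          (𝓝 0) := by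
        simpa using ((hκ.sub ((hceil' t).comp hχ)).abs).const_mul V
      refine squeeze_zero_norm' ?_ h2
      filter_upwards [hψχ.eventually (hvalid' t), hψχ.eventually (hA.eventually_lt_atBot (t - 1)),
        hψχ.eventually (hE.eventually_gt_atTop (t + 1)),
        hκ.eventually_lt_const (show t < t + 1 by linarith),
        hκ.eventually_const_lt (show t - 1 < t by linarith)] with n h3 h4 h5 h6 h7
      have h8 : A (ψ (χ n)) < κ n := (hX _).lt_iff_lt.1 (h4.trans h7)
      have h9 : κ n < E (ψ (χ n)) := (hX _).lt_iff_lt.1 (h6.trans h5)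
      simp only [Function.comp_apply] at h3
      exact hlip _ _ _ (by omega) h3.2 h8.le h9.le
    simpa using h1.add ((hw t).comp hχ)

/-- The subdivision of each interval `[b j, b (j + 1)]` into `N` equal pieces. -/
noncomputable def gridPt (b : ℤ → ℝ) (N : ℕ) (k : ℤ) : ℝ :=
  b (k / N) + ((k % N : ℤ) : ℝ) / N * (b (k / N + 1) - b (k / N))

section gridPt

variable {b : ℤ → ℝ} {N : ℕ}

lemma gridPt_mul (hN : 0 < N) (j : ℤ) : gridPt b N (N * j) = b j := by
  have hN' : (N : ℤ) ≠ 0 := by omega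
  simp [gridPt, Int.mul_ediv_cancel_left _ hN']

lemma gridPt_mul_add (hN : 0 < N) (j : ℤ) {i : ℕ} (hi : i ≤ N) :
    gridPt b N (N * j + i) = b j + i / N * (b (j + 1) - b j) := by
  have hN' : (N : ℤ) ≠ 0 := by omega
  rcases hi.lt_or_eq with hi | rfl
  · have h1 : ((N : ℤ) * j + i) / N = j := by
      rw [Int.add_comm, Int.add_mul_ediv_left _ _ hN', Int.ediv_eq_zero_of_lt] <;> omega
    have h2 : ((N : ℤ) * j + i) % N = i := by
      rw [Int.add_comm, Int.add_mul_emod_self_left]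
      exact Int.emod_eq_of_lt (by omega) (by omega)
    simp [gridPt, h1, h2]
  · rw [show (i : ℤ) * j + i = i * (j + 1) by ring, gridPt_mul hN,
      div_self (by exact_mod_cast hN.ne')]
    ring

lemma gridPt_succ_sub (hN : 0 < N) (k : ℤ) :
    gridPt b N (k + 1) - gridPt b N k = (b (k / N + 1) - b (k / N)) / N := by
  have h0 : (0 : ℤ) < N := by omega
  obtain ⟨i, hi⟩ := Int.eq_ofNat_of_zero_le (Int.emod_nonneg k h0.ne')
  have hk : k = N * (k / N) + i := by rw [← hi]; exact (Int.mul_ediv_add_emod k N).symm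
  have hiN : i < N := by have := Int.emod_lt_of_pos k h0; omega
  have h1 := gridPt_mul_add (b := b) hN (k / N) hiN.le
  have h2 := gridPt_mul_add (b := b) hN (k / N) (show i + 1 ≤ N from hiN)
  rw [← hk] at h1
  rw [Nat.cast_add, Nat.cast_one, ← add_assoc, ← hk] at h2
  rw [h1, h2]
  push_cast
  ring

lemma gridPt_strictMono (hN : 0 < N) (hb : ∀ k, b k < b (k + 1)) : StrictMono (gridPt b N) := by
  refine strictMono_int_of_lt_succ fun k => sub_pos.1 ?_
  rw [gridPt_succ_sub hN]
  have := sub_pos.2 (hb (k / N))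
  positivity

lemma gridPt_mem_Icc (hN : 0 < N) (hb : ∀ k, b k < b (k + 1)) {j k : ℤ} (h1 : N * j ≤ k)
    (h2 : k ≤ N * (j + 1)) : gridPt b N k ∈ Icc (b j) (b (j + 1)) := by
  have hm := (gridPt_strictMono hN hb).monotone
  rw [← gridPt_mul (b := b) hN j, ← gridPt_mul (b := b) hN (j + 1)]
  exact ⟨hm h1, hm h2⟩

/-- Grid points approximate the points of an interval. -/
lemma exists_gridPt_near (hN : 0 < N) (hb : ∀ k, b k < b (k + 1)) {j : ℤ} {t : ℝ}
    (ht : t ∈ Icc (b j) (b (j + 1))) :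
    ∃ k : ℤ, N * j ≤ k ∧ k ≤ N * (j + 1) ∧ |gridPt b N k - t| ≤ (b (j + 1) - b j) / N := by
  have hlen := sub_pos.2 (hb j)
  have hN' : (0 : ℝ) < N := by exact_mod_cast hN
  set θ := (t - b j) / (b (j + 1) - b j) with hθ
  have hθ0 : 0 ≤ θ := div_nonneg (sub_nonneg.2 ht.1) hlen.le
  have hθ1 : θ ≤ 1 := (div_le_one hlen).2 (by linarith [ht.2])
  have htθ : t = b j + θ * (b (j + 1) - b j) := by
    rw [hθ, div_mul_cancel₀ _ hlen.ne']; ring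
  have hi1 := Nat.floor_le (mul_nonneg hθ0 hN'.le)
  have hi2 := Nat.lt_floor_add_one (θ * N)
  have hiN : ⌊θ * N⌋₊ ≤ N := by
    have : (⌊θ * N⌋₊ : ℝ) ≤ N := by nlinarith
    exact_mod_cast this
  refine ⟨N * j + ⌊θ * N⌋₊, by omega, by rw [mul_add, mul_one]; omega, ?_⟩
  rw [gridPt_mul_add hN j hiN]
  rw [show b j + (⌊θ * N⌋₊ : ℝ) / N * (b (j + 1) - b j) - t =
    (⌊θ * N⌋₊ - θ * N) * ((b (j + 1) - b j) / N) by rw [htθ]; field_simp; ring, abs_mul,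
    abs_of_pos (div_pos hlen hN')]
  have h3 : |(⌊θ * N⌋₊ : ℝ) - θ * N| ≤ 1 := by rw [abs_le]; constructor <;> linarith
  have h4 := div_pos hlen hN'
  nlinarith

end gridPt

namespace ShootingConstants

/-- Compatibility of a weight `q` with the constants: `q` is nonnegative on the intervals
`[b (2 * j), b (2 * j + 1)]` and nonpositive on the intervals `[b (2 * j - 1), b (2 * j)]`. -/
structure Weight (p : ShootingConstants) (b : ℤ → ℝ) (q : ℝ → ℝ) (D : ℕ) : Prop where
  lt_succ : ∀ k, b k < b (k + 1)
  loc : LocallyIntegrable q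
  plus : ∀ j, ∀ᵐ t, t ∈ Icc (b (2 * j)) (b (2 * j + 1)) → 0 ≤ q t
  minus : ∀ j, ∀ᵐ t, t ∈ Icc (b (2 * j - 1)) (b (2 * j)) → q t ≤ 0
  len_le : ∀ k, b (k + 1) - b k ≤ p.L
  le_len : ∀ j, p.l₀ ≤ b (2 * j + 1) - b (2 * j)
  mass_plus : ∀ j, ∫ t in b (2 * j)..b (2 * j + 1), q t ≤ p.LA
  mass_minus : ∀ j, ∫ t in b (2 * j - 1)..b (2 * j), q t ≤ -p.MB
  two_le : 2 ≤ D
  ε_le : ∀ j, p.ε ≤ (b (2 * j + 1) - b (2 * j)) / D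
  mass_core : ∀ j, p.LB ≤ ∫ t in (b (2 * j) + (b (2 * j + 1) - b (2 * j)) / D)..
    (b (2 * j + 1) - (b (2 * j + 1) - b (2 * j)) / D), q t

variable {p : ShootingConstants} {b : ℤ → ℝ} {q h : ℝ → ℝ} {D : ℕ}

lemma Weight.intervalIntegrable (hW : p.Weight b q D) (s t : ℝ) :
    IntervalIntegrable q volume s t :=
  (hW.loc.integrableOn_isCompact isCompact_uIcc).intervalIntegrable

lemma Weight.integral_sub (hW : p.Weight b q D) (s t : ℝ) :
    (∫ y in (0 : ℝ)..t, q y) - ∫ y in (0 : ℝ)..s, q y = ∫ y in s..t, q y :=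
  intervalIntegral.integral_interval_sub_left (hW.intervalIntegrable _ _)
    (hW.intervalIntegrable _ _)

lemma Weight.integral_nonneg (hW : p.Weight b q D) {j : ℤ} {s t : ℝ} (hs : b (2 * j) ≤ s)
    (hst : s ≤ t) (ht : t ≤ b (2 * j + 1)) : 0 ≤ ∫ y in s..t, q y := by
  refine intervalIntegral.integral_nonneg_of_ae_restrict hst ?_
  rw [EventuallyLE, ae_restrict_iff' measurableSet_Icc]
  filter_upwards [hW.plus j] with y hy hy'
  exact hy ⟨hs.trans hy'.1, hy'.2.trans ht⟩

lemma Weight.integral_nonpos (hW : p.Weight b q D) {j : ℤ} {s t : ℝ} (hs : b (2 * j - 1) ≤ s)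
    (hst : s ≤ t) (ht : t ≤ b (2 * j)) : ∫ y in s..t, q y ≤ 0 := by
  rw [← neg_nonneg, ← intervalIntegral.integral_neg]
  refine intervalIntegral.integral_nonneg_of_ae_restrict hst ?_
  rw [EventuallyLE, ae_restrict_iff' measurableSet_Icc]
  filter_upwards [hW.minus j] with y hy hy'
  exact neg_nonneg.2 (hy ⟨hs.trans hy'.1, hy'.2.trans ht⟩)

/-- The part of the subdivision which starts at `b (-2 * n - 1)` is compatible with the
constants. -/
lemma Weight.grid (hW : p.Weight b q D) (n : ℕ) {e : ℕ} (he : 0 < e) :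
    p.Grid (fun i => gridPt b (e * D) ((e * D : ℕ) * (-2 * n - 1) + i))
      (fun i => ∫ t in (0 : ℝ)..gridPt b (e * D) ((e * D : ℕ) * (-2 * n - 1) + i), q t)
      (fun c => c * (e * D)) (fun l => (2 * l + 1) * (e * D) + e)
      (fun l => (2 * l + 2) * (e * D) - e) := by
  have hD := hW.two_le
  have hN : 0 < e * D := by positivity
  have heN : e * 2 ≤ e * D := Nat.mul_le_mul_left e hD
  have hDpos : (0 : ℝ) < D := by exact_mod_cast (by omega : 0 < D)
  have hepos : (0 : ℝ) < e := by exact_mod_cast he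
  set N := e * D with hNdef
  have hmono := gridPt_strictMono hN hW.lt_succ
  have hK : ∀ c : ℕ, gridPt b N ((N : ℤ) * (-2 * n - 1) + (c * N : ℕ)) = b (c - 2 * n - 1) := by
    intro c
    rw [← gridPt_mul (b := b) hN]
    congr 1
    push_cast
    ring
  have hK₀ : ∀ l : ℕ, gridPt b N ((N : ℤ) * (-2 * n - 1) + (2 * l * N : ℕ)) =
      b (2 * ((l : ℤ) - n) - 1) := fun l => by
    rw [hK]; congr 1; push_cast; ring
  have hK₁ : ∀ l : ℕ, gridPt b N ((N : ℤ) * (-2 * n - 1) + ((2 * l + 1) * N : ℕ)) =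
      b (2 * ((l : ℤ) - n)) := fun l => by
    rw [hK]; congr 1; push_cast; ring
  have hK₂ : ∀ l : ℕ, gridPt b N ((N : ℤ) * (-2 * n - 1) + ((2 * l + 2) * N : ℕ)) =
      b (2 * ((l : ℤ) - n) + 1) := fun l => by
    rw [hK]; congr 1; push_cast; ring
  have hn₁ : ∀ l : ℕ, gridPt b N ((N : ℤ) * (-2 * n - 1) + ((2 * l + 1) * N + e : ℕ)) =
      b (2 * ((l : ℤ) - n)) + (b (2 * ((l : ℤ) - n) + 1) - b (2 * ((l : ℤ) - n))) / D := fun l => by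
    have h1 := gridPt_mul_add (b := b) hN (2 * ((l : ℤ) - n)) (show e ≤ N by omega)
    rw [show (N : ℤ) * (-2 * n - 1) + ((2 * l + 1) * N + e : ℕ) = N * (2 * ((l : ℤ) - n)) + e by
      push_cast; ring, h1, hNdef]
    push_cast
    field_simp
  have hn₂ : ∀ l : ℕ, gridPt b N ((N : ℤ) * (-2 * n - 1) + ((2 * l + 2) * N - e : ℕ)) =
      b (2 * ((l : ℤ) - n) + 1) - (b (2 * ((l : ℤ) - n) + 1) - b (2 * ((l : ℤ) - n))) / D :=
    fun l => by
    have h1 := gridPt_mul_add (b := b) hN (2 * ((l : ℤ) - n)) (show N - e ≤ N by omega)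
    have h2 : e ≤ (2 * l + 2) * N := by nlinarith
    rw [show (N : ℤ) * (-2 * n - 1) + ((2 * l + 2) * N - e : ℕ) =
      N * (2 * ((l : ℤ) - n)) + (N - e : ℕ) by
        rw [Nat.cast_sub h2, Nat.cast_sub (by omega)]; push_cast; ring, h1,
      Nat.cast_sub (by omega), hNdef]
    push_cast
    field_simp
    ring
  have hle : ∀ i i' : ℕ, i ≤ i' → gridPt b N ((N : ℤ) * (-2 * n - 1) + i) ≤
      gridPt b N ((N : ℤ) * (-2 * n - 1) + i') := fun i i' hi => hmono.monotone (by omega)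
  have hord : ∀ l : ℕ, (2 * l + 1) * N + N = (2 * l + 2) * N := fun l => by ring
  refine ⟨fun i => hmono (by push_cast; omega), by simp, fun c d hcd => Nat.mul_le_mul_right _ hcd,
    fun l i hi hi' => ?_, fun l i hi hi' => ?_, fun l => ?_, fun l => ?_, fun l => ?_, fun l => ?_,
    fun l => ?_, fun l => ?_, fun l => ?_, fun l => ?_, fun l => ?_, fun l => ?_, fun l => ?_⟩
  · rw [← sub_nonpos, hW.integral_sub]
    refine hW.integral_nonpos (j := (l : ℤ) - n) ?_ (hle _ _ (Nat.le_succ i)) ?_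
    · rw [← hK₀]; exact hle _ _ hi
    · rw [← hK₁]; exact hle _ _ hi'
  · rw [← sub_nonneg, hW.integral_sub]
    refine hW.integral_nonneg (j := (l : ℤ) - n) ?_ (hle _ _ (Nat.le_succ i)) ?_
    · rw [← hK₁]; exact hle _ _ hi
    · rw [← hK₂]; exact hle _ _ hi'
  · simp only [hK₀, hK₁]
    have := hW.len_le (2 * ((l : ℤ) - n) - 1)
    rwa [sub_add_cancel] at this
  · simp only [hK₁, hK₂]
    exact hW.len_le _
  · simp only [hK₁, hK₂]
    exact hW.le_len _
  · simp only [hK₀, hK₁]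
    have := hW.integral_sub (b (2 * ((l : ℤ) - n) - 1)) (b (2 * ((l : ℤ) - n)))
    linarith [hW.mass_minus ((l : ℤ) - n)]
  · simp only [hK₁, hK₂, hW.integral_sub]
    exact hW.mass_plus _
  · exact Nat.le_add_right _ _
  · have := hord l
    show (2 * l + 1) * N + e ≤ (2 * l + 2) * N - e
    omega
  · exact Nat.sub_le _ _
  · simp only [hK₁, hn₁]
    linarith [hW.ε_le ((l : ℤ) - n)]
  · simp only [hK₂, hn₂]
    linarith [hW.ε_le ((l : ℤ) - n)]
  · simp only [hn₁, hn₂, hW.integral_sub]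
    exact hW.mass_core _

/-- A trajectory on the subdivision following the prescribed code between `b (-2 * n)` and
`b (2 * n + 1)`. -/
lemma Weight.exists_kick (hp : p.Nonlinearity h) (hW : p.Weight b q D) (S : ℤ → Fin 3) (n : ℕ)
    {e : ℕ} (he : 0 < e) :
    ∃ u v : ℤ → ℝ, (∀ k, u k ∈ Icc 0 p.z₄) ∧ (∀ k, |v k| ≤ p.slope) ∧
      (∀ k : ℤ, (e * D : ℕ) * (-2 * n) ≤ k → k < (e * D : ℕ) * (2 * n + 1) →
        u (k + 1) = u k + (gridPt b (e * D) (k + 1) - gridPt b (e * D) k) * v k) ∧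
      (∀ k : ℤ, (e * D : ℕ) * (-2 * n) ≤ k → k < (e * D : ℕ) * (2 * n + 1) →
        v (k + 1) = v k -
          (∫ s in gridPt b (e * D) k..gridPt b (e * D) (k + 1), q s) * h (u (k + 1))) ∧
      ∀ j : ℤ, -n ≤ j → j ≤ n →
        (∀ k : ℤ, (e * D : ℕ) * (2 * j) ≤ k → k ≤ (e * D : ℕ) * (2 * j + 1) → u k ≤ p.upper (S j)) ∧
        ∃ k : ℤ, (e * D : ℕ) * (2 * j) ≤ k ∧ k ≤ (e * D : ℕ) * (2 * j + 1) ∧ p.lower (S j) ≤ u k := by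
  obtain ⟨U, V, H, hC, hB⟩ := exists_kick_codes hp (hW.grid n he) (fun l => S (l - n))
    (l := 2 * n + 1) (by omega)
  have hD := hW.two_le
  have hN : 0 < e * D := by positivity
  set N := e * D
  set k₀ : ℤ := N * (-2 * n - 1) with hk₀
  have hA : (N : ℤ) * (-2 * n) = k₀ + N := by rw [hk₀]; ring
  have hE : (N : ℤ) * (2 * n + 1) = k₀ + (2 * (2 * n + 1) * N : ℕ) := by rw [hk₀]; push_cast; ring
  have hz := hp.z₄_pos
  have hsl := hp.slope_pos
  rw [hA, hE]
  simp only [one_mul] at hB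
  set M := 2 * (2 * n + 1) * N with hM
  have hex : ∀ k, k₀ + N ≤ k → k ≤ k₀ + M → ∃ i : ℕ, k = k₀ + i ∧ N ≤ i ∧ i ≤ M := fun k h1 h2 =>
    ⟨(k - k₀).toNat, by omega, by omega, by omega⟩
  set u : ℤ → ℝ := fun k => if k₀ + N ≤ k ∧ k ≤ k₀ + M then U (k - k₀).toNat else 0 with hu
  set v : ℤ → ℝ := fun k => if k₀ + N ≤ k ∧ k ≤ k₀ + M then V (k - k₀).toNat else 0 with hv
  have hu' : ∀ i : ℕ, N ≤ i → i ≤ M → u (k₀ + i) = U i := fun i h1 h2 => by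
    simp only [hu]
    rw [if_pos (by omega)]
    simp
  have hv' : ∀ i : ℕ, N ≤ i → i ≤ M → v (k₀ + i) = V i := fun i h1 h2 => by
    simp only [hv]
    rw [if_pos (by omega)]
    simp
  refine ⟨u, v, fun k => ?_, fun k => ?_, fun k h1 h2 => ?_, fun k h1 h2 => ?_,
    fun j h1 h2 => ?_⟩
  · by_cases hk : k₀ + N ≤ k ∧ k ≤ k₀ + M
    · obtain ⟨i, rfl, h1, h2⟩ := hex k hk.1 hk.2
      rw [hu' i h1 h2]
      exact (hB i h1 h2).1
    · simp only [hu, if_neg hk]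
      exact ⟨le_rfl, hz.le⟩
  · by_cases hk : k₀ + N ≤ k ∧ k ≤ k₀ + M
    · obtain ⟨i, rfl, h1, h2⟩ := hex k hk.1 hk.2
      rw [hv' i h1 h2]
      exact (hB i h1 h2).2
    · simp only [hv, if_neg hk, abs_zero]
      exact hsl.le
  · obtain ⟨i, rfl, h3, h4⟩ := hex k h1 h2.le
    have h5 := hu' (i + 1) (by omega) (by omega)
    have h6 := H.drift i
    push_cast at h5 h6
    rw [← add_assoc] at h5 h6
    rw [h5, hu' i h3 h4, hv' i h3 h4, h6]
  · obtain ⟨i, rfl, h3, h4⟩ := hex k h1 h2.le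
    have h5 := hu' (i + 1) (by omega) (by omega)
    have h7 := hv' (i + 1) (by omega) (by omega)
    have h6 := H.kick i
    push_cast at h5 h6 h7
    rw [← add_assoc] at h5 h6 h7
    rw [h5, h7, hv' i h3 h4, h6, hW.integral_sub]
  · obtain ⟨l, hl⟩ := Int.eq_ofNat_of_zero_le (show 0 ≤ j + n by omega)
    have hj : j = l - n := by omega
    obtain ⟨hC₁, i, hi, hi', hC₂⟩ := hC l (by omega)
    have hlo : (N : ℤ) * (2 * j) = k₀ + ((2 * l + 1) * N : ℕ) := by
      rw [hk₀, hj]; push_cast; ring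
    have hhi : (N : ℤ) * (2 * j + 1) = k₀ + ((2 * l + 2) * N : ℕ) := by
      rw [hk₀, hj]; push_cast; ring
    have hloN : N ≤ (2 * l + 1) * N := Nat.le_mul_of_pos_left N (by omega)
    have hhiM : (2 * l + 2) * N ≤ M := Nat.mul_le_mul_right N (by omega)
    replace hi : (2 * l + 1) * N ≤ i := hi
    replace hi' : i ≤ (2 * l + 2) * N := hi'
    rw [hlo, hhi, hj]
    refine ⟨fun k h3 h4 => ?_, k₀ + i, by omega, by omega, ?_⟩
    · obtain ⟨i, rfl, h5, h6⟩ := hex k (by omega) (by omega)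
      rw [hu' i h5 h6]
      exact hC₁ i (by show (2 * l + 1) * N ≤ i; omega) (by show i ≤ (2 * l + 2) * N; omega)
    · rw [hu' i (by omega) (by omega)]
      exact hC₂

lemma Weight.tendsto_atTop (hp : p.Nonlinearity h) (hW : p.Weight b q D) :
    Tendsto (fun n : ℕ => b (2 * n)) atTop atTop := by
  have h1 : ∀ n : ℕ, b 0 + n * p.l₀ ≤ b (2 * n) := by
    intro n
    induction n with
    | zero => simp
    | succ n ih =>
      have h2 := hW.le_len n
      have h3 := hW.lt_succ (2 * n + 1)
      rw [show ((2 : ℤ) * n + 1 + 1) = 2 * (n + 1 : ℕ) by push_cast; ring] at h3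
      push_cast at h3 ⊢
      linarith
  refine tendsto_atTop_mono h1 ?_
  exact tendsto_atTop_add_const_left _ _ (tendsto_natCast_atTop_atTop.atTop_mul_const hp.l₀_pos)

lemma Weight.tendsto_atBot (hp : p.Nonlinearity h) (hW : p.Weight b q D) :
    Tendsto (fun n : ℕ => b (-2 * n)) atTop atBot := by
  have h1 : ∀ n : ℕ, b (-2 * n) ≤ b 0 - n * p.l₀ := by
    intro n
    induction n with
    | zero => simp
    | succ n ih =>
      have h2 := hW.le_len (-(n : ℤ) - 1)
      have h3 := hW.lt_succ (2 * (-(n : ℤ) - 1) + 1)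
      rw [show ((2 : ℤ) * (-(n : ℤ) - 1) + 1 + 1) = -2 * n by ring] at h3
      rw [show ((2 : ℤ) * (-(n : ℤ) - 1)) = -2 * (n + 1 : ℕ) by push_cast; ring] at h2 h3
      push_cast at h2 h3 ⊢
      linarith
  refine tendsto_atBot_mono h1 ?_
  exact tendsto_atBot_add_const_left _ _ (tendsto_neg_atTop_atBot.comp
    (tendsto_natCast_atTop_atTop.atTop_mul_const hp.l₀_pos))

/-- For every code there is a bounded solution on the whole line following it. -/
theorem Weight.exists_isSolR (hp : p.Nonlinearity h) (hW : p.Weight b q D) (S : ℤ → Fin 3) :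
    ∃ w z : ℝ → ℝ, IsSolR q h w z ∧ (∀ t, w t ∈ Icc 0 p.z₄) ∧
      ∀ j, (∀ t ∈ Icc (b (2 * j)) (b (2 * j + 1)), w t ≤ p.upper (S j)) ∧
        ∃ t ∈ Icc (b (2 * j)) (b (2 * j + 1)), p.lower (S j) ≤ w t := by
  have hD := hW.two_le
  have hN : ∀ n : ℕ, 0 < (n + 1) * D := fun n => by positivity
  have hLpos := hp.L_pos
  choose u v hu hv hdrift hkick hcode using fun n : ℕ =>
    hW.exists_kick hp S n (e := n + 1) (by omega)
  have hmono := fun n => gridPt_strictMono (hN n) hW.lt_succ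
  have hδ : Tendsto (fun n : ℕ => p.L / ((n + 1) * D : ℕ)) atTop (𝓝 0) := by
    refine Tendsto.const_div_atTop (tendsto_natCast_atTop_atTop.comp ?_) _
    exact tendsto_atTop_mono (fun n => (by nlinarith : n ≤ (n + 1) * D)) tendsto_id
  obtain ⟨ψ, w, z, hψ, hsol, hw, hlim⟩ := exists_subseq_tendsto_isSolR
    (X := fun n => gridPt b ((n + 1) * D)) (u := u) (v := v)
    (A := fun n => ((n + 1) * D : ℕ) * (-2 * n)) (E := fun n => ((n + 1) * D : ℕ) * (2 * n + 1))
    (C := p.z₄ / (4 * p.L * p.LA)) hW.loc hp.cont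
    (fun s => by rw [abs_of_nonneg (hp.nonneg s)]; exact hp.le_z₄ s) hmono
    (fun n => tendsto_atTop_atTop_of_monotone (hmono n).monotone fun C => by
      obtain ⟨j, hj⟩ := ((hW.tendsto_atTop hp).eventually_ge_atTop C).exists
      exact ⟨((n + 1) * D : ℕ) * (2 * j), by rwa [gridPt_mul (hN n)]⟩)
    (fun n => tendsto_atBot_atBot_of_monotone (hmono n).monotone fun C => by
      obtain ⟨j, hj⟩ := ((hW.tendsto_atBot hp).eventually_le_atBot C).exists
      exact ⟨((n + 1) * D : ℕ) * (-2 * j), by rwa [gridPt_mul (hN n)]⟩)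
    hδ (fun n k => by
      rw [gridPt_succ_sub (hN n)]
      exact div_le_div_of_nonneg_right (hW.len_le _) (Nat.cast_nonneg _))
    ((hW.tendsto_atBot hp).congr fun n => (gridPt_mul (hN n) _).symm)
    (tendsto_atTop_mono (fun n => by
      rw [gridPt_mul (hN n)]
      exact (hW.lt_succ _).le) (hW.tendsto_atTop hp)) hu hv hdrift hkick
  refine ⟨w, z, hsol, hw, fun j => ⟨fun t ht => ?_, ?_⟩⟩
  · choose κ hκ₁ hκ₂ hκ₃ using fun n => exists_gridPt_near (hN (ψ n)) hW.lt_succ ht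
    have h1 : Tendsto (fun n => gridPt b ((ψ n + 1) * D) (κ n)) atTop (𝓝 t) := by
      rw [tendsto_iff_dist_tendsto_zero]
      refine squeeze_zero (fun _ => dist_nonneg) (fun n => ?_) (hδ.comp hψ.tendsto_atTop)
      exact (hκ₃ n).trans (div_le_div_of_nonneg_right (hW.len_le _) (Nat.cast_nonneg _))
    refine le_of_tendsto (hlim t id κ tendsto_id h1) ?_
    filter_upwards [hψ.tendsto_atTop.eventually_ge_atTop j.natAbs] with n hn
    exact (hcode (ψ n) j (by omega) (by omega)).1 _ (hκ₁ n) (hκ₂ n)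
  · have h0 : ∀ n : ℕ, ∃ k : ℤ, gridPt b ((ψ n + 1) * D) k ∈ Icc (b (2 * j)) (b (2 * j + 1)) ∧
        (j.natAbs ≤ ψ n → p.lower (S j) ≤ u (ψ n) k) := by
      intro n
      by_cases hn : j.natAbs ≤ ψ n
      · obtain ⟨k, h1, h2, h3⟩ := (hcode (ψ n) j (by omega) (by omega)).2
        exact ⟨k, gridPt_mem_Icc (hN _) hW.lt_succ h1 h2, fun _ => h3⟩
      · refine ⟨((ψ n + 1) * D : ℕ) * (2 * j), ?_, fun h => absurd h hn⟩
        rw [gridPt_mul (hN _)]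
        exact left_mem_Icc.2 (hW.lt_succ _).le
    choose κ hκ hκ' using h0
    obtain ⟨t, ht, χ, hχ, hχt⟩ := isCompact_Icc.tendsto_subseq hκ
    refine ⟨t, ht, ge_of_tendsto (hlim t χ (κ ∘ χ) hχ.tendsto_atTop hχt) ?_⟩
    filter_upwards [(hψ.tendsto_atTop.comp hχ.tendsto_atTop).eventually_ge_atTop j.natAbs]
      with n hn
    exact hκ' (χ n) hn

end ShootingConstants

/-- A nonnegative solution which vanishes somewhere vanishes identically. -/
lemma IsSolR.eq_zero_of_eq_zero {q h w z : ℝ → ℝ} {H : ℝ} (hsol : IsSolR q h w z)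
    (hq : LocallyIntegrable q) (hh : ∀ s, 0 ≤ s → |h s| ≤ H * s) (hw : ∀ t, 0 ≤ w t) {t₀ : ℝ}
    (ht₀ : w t₀ = 0) (t : ℝ) : w t = 0 := by
  have hcont : Continuous w := continuous_iff_continuousAt.2 fun t => (hsol.1 t).continuousAt
  have hqi : ∀ s t, IntervalIntegrable (fun y => |q y|) volume s t := fun s t =>
    (hq.integrableOn_isCompact isCompact_uIcc).intervalIntegrable.abs
  have hclosed : IsClosed {t | w t = 0} := isClosed_singleton.preimage hcont
  have hopen : IsOpen {t | w t = 0} := by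
    refine isOpen_iff_mem_nhds.2 fun s hs => ?_
    have hs' : w s = 0 := hs
    have hzs : z s = 0 := IsLocalMin.hasDerivAt_eq_zero
      (Eventually.of_forall fun y => by rw [hs']; exact hw y) (hsol.1 s)
    have h1 : Tendsto (fun y => H * abs (∫ x in s..y, |q x|)) (𝓝 s) (𝓝 0) := by
      have := ((intervalIntegral.continuous_primitive hqi s).tendsto s).abs.const_mul H
      simpa using this
    obtain ⟨d, hd, hd'⟩ := Metric.eventually_nhds_iff.1
      (h1.eventually_le_const (show (0 : ℝ) < 1 / 2 by norm_num))
    set e := min (d / 2) 1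
    have he : 0 < e := by positivity
    have hed : e < d := (min_le_left _ _).trans_lt (by linarith)
    have he1 : e ≤ 1 := min_le_right _ _
    have hsmem : s ∈ Icc (s - e) (s + e) := ⟨by linarith, by linarith⟩
    obtain ⟨x, hx, hmax⟩ := isCompact_Icc.exists_isMaxOn ⟨s, hsmem⟩ hcont.continuousOn
    have hz : ∀ y ∈ Icc (s - e) (s + e), ‖z y‖ ≤ w x / 2 := by
      intro y hy
      have hys : |y - s| ≤ e := abs_le.2 ⟨by linarith [hy.1], by linarith [hy.2]⟩
      have h2 : ‖∫ r in s..y, q r * h (w r)‖ ≤ |∫ r in s..y, |q r| * (H * w x)| := by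
        refine intervalIntegral.norm_integral_le_abs_of_norm_le ?_ ((hqi s y).mul_const _)
        refine (ae_restrict_iff' measurableSet_uIoc).2 (Eventually.of_forall fun r hr => ?_)
        rw [Real.norm_eq_abs, abs_mul]
        have hr' : r ∈ Icc (s - e) (s + e) := by
          have h3 := uIcc_subset_Icc hsmem hy (uIoc_subset_uIcc hr)
          exact h3
        have hwr : w r ≤ w x := hmax hr'
        have hH : 0 ≤ H ∨ w r = 0 := by
          by_contra! hc
          have h3 := (abs_nonneg _).trans (hh _ (hw r))
          have h4 : 0 < w r := lt_of_le_of_ne (hw r) (Ne.symm hc.2)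
          nlinarith
        refine mul_le_mul_of_nonneg_left ((hh _ (hw r)).trans ?_) (abs_nonneg _)
        rcases hH with hH | hH
        · exact mul_le_mul_of_nonneg_left hwr hH
        · rw [hH, mul_zero]
          exact (abs_nonneg _).trans (hh _ (hw x))
      rw [intervalIntegral.integral_mul_const, abs_mul,
        abs_of_nonneg ((abs_nonneg _).trans (hh _ (hw x)))] at h2
      have h3 := hd' (show dist y s < d by rw [Real.dist_eq]; linarith)
      rw [hsol.2 s y, hzs, zero_sub, norm_neg]
      nlinarith [hw x]
    have h2 := (convex_Icc (s - e) (s + e)).norm_image_sub_le_of_norm_hasDerivWithin_le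
      (fun y _ => (hsol.1 y).hasDerivWithinAt) hz hsmem hx
    have hxs : |x - s| ≤ 1 := abs_le.2 ⟨by linarith [hx.1], by linarith [hx.2]⟩
    rw [hs', sub_zero, Real.norm_eq_abs, Real.norm_eq_abs, abs_of_nonneg (hw x)] at h2
    have hx0 : w x = 0 := by nlinarith [hw x]
    filter_upwards [Icc_mem_nhds (show s - e < s by linarith) (show s < s + e by linarith)] with y hy
    exact le_antisymm ((hmax hy).trans hx0.le) (hw y)
  have := IsClopen.eq_univ ⟨hclosed, hopen⟩ ⟨t₀, ht₀⟩
  exact eq_univ_iff_forall.1 this t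

lemma exists_int_eq_add_mul {m : ℕ} (hm : 1 ≤ m) (j : ℤ) :
    ∃ i : ℕ, 1 ≤ i ∧ i ≤ m ∧ ∃ ℓ : ℤ, j = i + ℓ * m := by
  have h0 : (0 : ℤ) < m := by omega
  have h1 := Int.emod_nonneg (j - 1) h0.ne'
  have h2 := Int.emod_lt_of_pos (j - 1) h0
  have h3 := Int.mul_ediv_add_emod (j - 1) m
  refine ⟨((j - 1) % m).toNat + 1, by omega, by omega, (j - 1) / m, ?_⟩
  rw [mul_comm] at h3
  push_cast
  rw [Int.toNat_of_nonneg h1]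
  omega

/-- The periodic extension of the end points of the intervals. -/
lemma exists_boundary {m : ℕ} (hm : 1 ≤ m) {σ τ : ℕ → ℝ} {T : ℝ} (hσT : σ (m + 1) - σ 1 = T) :
    ∃ b : ℤ → ℝ, ∀ i : ℕ, 1 ≤ i → i ≤ m → ∀ ℓ : ℤ, b (2 * (i + ℓ * m)) = σ i + ℓ * T ∧
      b (2 * (i + ℓ * m) + 1) = τ i + ℓ * T ∧ b (2 * (i + ℓ * m) + 2) = σ (i + 1) + ℓ * T := by
  have h0 : (m : ℤ) ≠ 0 := by omega
  have hmod : ∀ i : ℕ, 1 ≤ i → i ≤ m → ∀ ℓ : ℤ, (((i : ℤ) + ℓ * m - 1) % m).toNat + 1 = i := by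
    intro i hi him ℓ
    rw [show (i : ℤ) + ℓ * m - 1 = i - 1 + ℓ * m by ring, Int.add_mul_emod_self_right,
      Int.emod_eq_of_lt (by omega) (by omega)]
    omega
  have hdiv : ∀ i : ℕ, 1 ≤ i → i ≤ m → ∀ ℓ : ℤ, ((i : ℤ) + ℓ * m - 1) / m = ℓ := by
    intro i hi him ℓ
    rw [show (i : ℤ) + ℓ * m - 1 = i - 1 + ℓ * m by ring, Int.add_mul_ediv_right _ _ h0,
      Int.ediv_eq_zero_of_lt (by omega) (by omega), zero_add]
  set b : ℤ → ℝ := fun k => (if k % 2 = 0 then σ (((k / 2 - 1) % m).toNat + 1)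
    else τ (((k / 2 - 1) % m).toNat + 1)) + ((k / 2 - 1) / m : ℤ) * T with hb
  have hb₀ : ∀ i : ℕ, 1 ≤ i → i ≤ m → ∀ ℓ : ℤ, b (2 * (i + ℓ * m)) = σ i + ℓ * T := by
    intro i hi him ℓ
    have h1 : (2 * ((i : ℤ) + ℓ * m)) / 2 = i + ℓ * m := by omega
    simp only [hb, h1, hmod i hi him, hdiv i hi him]
    rw [if_pos (by omega)]
  refine ⟨b, fun i hi him ℓ => ⟨hb₀ i hi him ℓ, ?_, ?_⟩⟩
  · have h1 : (2 * ((i : ℤ) + ℓ * m) + 1) / 2 = i + ℓ * m := by omega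
    simp only [hb, h1, hmod i hi him, hdiv i hi him]
    rw [if_neg (by omega)]
  · rcases him.lt_or_eq with him | rfl
    · rw [← hb₀ (i + 1) (by omega) him ℓ]
      congr 1
      push_cast
      ring
    · rw [show 2 * ((i : ℤ) + ℓ * i) + 2 = 2 * ((1 : ℕ) + (ℓ + 1) * i) by push_cast; ring,
        hb₀ 1 le_rfl hm]
      push_cast
      linarith

lemma exists_weight_constants {a : ℝ → ℝ} {m : ℕ} {σ τ : ℕ → ℝ}
    (hστ : ∀ i, 1 ≤ i → i ≤ m → σ i < τ i) (ha_loc : LocallyIntegrable a)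
    (ha_pos : ∀ i, 1 ≤ i → i ≤ m → 0 < ∫ t in (σ i)..(τ i), a t)
    (ha_neg : ∀ i, 1 ≤ i → i ≤ m → (∫ t in (τ i)..(σ (i + 1)), a t) < 0) :
    ∃ (L l₀ A₀ A₁ : ℝ) (D : ℕ), 0 < L ∧ 0 < l₀ ∧ 0 < A₀ ∧ 0 < A₁ ∧ 2 ≤ D ∧
      ∀ i, 1 ≤ i → i ≤ m → τ i - σ i ≤ L ∧ σ (i + 1) - τ i ≤ L ∧ l₀ ≤ τ i - σ i ∧
        (∫ t in (σ i)..(τ i), a t) ≤ A₁ ∧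
        A₀ ≤ (∫ t in (σ i + (τ i - σ i) / D)..(τ i - (τ i - σ i) / D), a t) ∧
        (∫ t in (τ i)..(σ (i + 1)), a t) ≤ -A₀ := by
  have hi : ∀ s t, IntervalIntegrable a volume s t := fun s t =>
    (ha_loc.integrableOn_isCompact isCompact_uIcc).intervalIntegrable
  have hfin : ∀ {ι : Type} {l : Filter ι} {P : ι → ℕ → Prop},
      (∀ i, 1 ≤ i → i ≤ m → ∀ᶠ x in l, P x i) → ∀ᶠ x in l, ∀ i, 1 ≤ i → i ≤ m → P x i := by
    intro ι l P hP
    have h1 : ∀ᶠ x in l, ∀ i ∈ Finset.Icc 1 m, P x i :=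
      (Filter.eventually_all_finset _).2 fun i hi =>
        hP i (Finset.mem_Icc.1 hi).1 (Finset.mem_Icc.1 hi).2
    filter_upwards [h1] with x hx i h2 h3
    exact hx i (Finset.mem_Icc.2 ⟨h2, h3⟩)
  obtain ⟨D, hD, hDcore⟩ : ∃ D : ℕ, 2 ≤ D ∧ ∀ i, 1 ≤ i → i ≤ m →
      0 < ∫ t in (σ i + (τ i - σ i) / D)..(τ i - (τ i - σ i) / D), a t := by
    refine ((eventually_ge_atTop 2).and (hfin fun i h1 h2 => ?_)).exists
    have h0 : Tendsto (fun D : ℕ => (τ i - σ i) / (D : ℝ)) atTop (𝓝 0) :=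
      tendsto_const_div_atTop_nhds_zero_nat _
    have h3 : Tendsto (fun D : ℕ =>
        ∫ t in (σ i + (τ i - σ i) / D)..(τ i - (τ i - σ i) / D), a t) atTop
        (𝓝 (∫ t in (σ i)..(τ i), a t)) := by
      have hc := intervalIntegral.continuous_primitive hi 0
      have h4 := (hc.tendsto (τ i)).comp (by simpa using h0.const_sub (τ i))
      have h5 := (hc.tendsto (σ i)).comp (by simpa using h0.const_add (σ i))
      have h6 := h4.sub h5
      rw [intervalIntegral.integral_interval_sub_left (hi _ _) (hi _ _)] at h6
      refine h6.congr fun D => ?_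
      exact intervalIntegral.integral_interval_sub_left (hi _ _) (hi _ _)
    exact h3.eventually_const_lt (ha_pos i h1 h2)
  obtain ⟨L, hL, hL'⟩ := ((eventually_gt_atTop (0 : ℝ)).and
    (hfin (P := fun L i => τ i - σ i ≤ L ∧ σ (i + 1) - τ i ≤ L) fun i _ _ =>
      (eventually_ge_atTop _).and (eventually_ge_atTop _))).exists
  obtain ⟨A₁, hA₁, hA₁'⟩ := ((eventually_gt_atTop (0 : ℝ)).and
    (hfin (P := fun A i => (∫ t in (σ i)..(τ i), a t) ≤ A) fun i _ _ =>
      eventually_ge_atTop _)).exists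
  have hsmall : ∀ {y : ℝ}, 0 < y → ∀ᶠ x in 𝓝[>] (0 : ℝ), x ≤ y := fun hy =>
    nhdsWithin_le_nhds (eventually_le_nhds hy)
  have hself : ∀ᶠ x in 𝓝[>] (0 : ℝ), 0 < x := self_mem_nhdsWithin
  obtain ⟨l₀, hl₀, hl₀'⟩ := (hself.and (hfin (P := fun l i => l ≤ τ i - σ i) fun i h1 h2 =>
    hsmall (sub_pos.2 (hστ i h1 h2)))).exists
  obtain ⟨A₀, hA₀, hA₀'⟩ := (hself.and (hfin (P := fun A i =>
    A ≤ (∫ t in (σ i + (τ i - σ i) / D)..(τ i - (τ i - σ i) / D), a t) ∧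
      A ≤ -∫ t in (τ i)..(σ (i + 1)), a t) fun i h1 h2 =>
    (hsmall (hDcore i h1 h2)).and (hsmall (neg_pos.2 (ha_neg i h1 h2))))).exists
  refine ⟨L, l₀, A₀, A₁, D, hL, hl₀, hA₀, hA₁, hD, fun i h1 h2 => ⟨(hL' i h1 h2).1, (hL' i h1 h2).2,
    hl₀' i h1 h2, hA₁' i h1 h2, (hA₀' i h1 h2).1, by linarith [(hA₀' i h1 h2).2]⟩⟩

/-- A continuous function which is positive on `(0, ∞)` is bounded away from zero there on compact
sets. -/
lemma exists_pos_forall_le {g : ℝ → ℝ} (hg : ContinuousOn g (Ici 0)) (hpos : ∀ s, 0 < s → 0 < g s)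
    {x y : ℝ} (hx : 0 < x) : ∃ c, 0 < c ∧ ∀ s ∈ Icc x y, c ≤ g s := by
  rcases (Icc x y).eq_empty_or_nonempty with h | h
  · exact ⟨1, one_pos, by simp [h]⟩
  · obtain ⟨t, ht, hmin⟩ := isCompact_Icc.exists_isMinOn h
      (hg.mono fun s hs => hx.le.trans hs.1)
    exact ⟨g t, hpos t (hx.trans_le ht.1), fun s hs => hmin hs⟩

/-- A sublinear function at infinity lies below a large multiple of its scale. -/
lemma exists_forall_le_mul {g : ℝ → ℝ} (hg : ContinuousOn g (Ici 0))
    (hginf : Tendsto (fun s => g s / s) atTop (𝓝 0)) {η : ℝ} (hη : 0 < η) (B : ℝ) :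
    ∃ z, B < z ∧ 0 < z ∧ ∀ s ∈ Icc 0 z, g s ≤ η * z := by
  obtain ⟨s₀, hs₀⟩ := eventually_atTop.1 (hginf.eventually_le_const hη)
  set s₁ := max s₀ 1
  obtain ⟨C, hC⟩ := isCompact_Icc.bddAbove_image 
    (hg.mono (Icc_subset_Ici_self : Icc 0 s₁ ⊆ Ici 0))
  have h1 : B < max (B + 1) (max 1 (C / η)) := lt_of_lt_of_le (by linarith) (le_max_left _ _)
  have h2 : 1 ≤ max (B + 1) (max 1 (C / η)) := (le_max_left _ _).trans (le_max_right _ _)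
  have h3 : C / η ≤ max (B + 1) (max 1 (C / η)) := (le_max_right _ _).trans (le_max_right _ _)
  refine ⟨_, h1, by linarith, fun s hs => ?_⟩
  rcases le_total s s₁ with h4 | h4
  · have h5 : g s ≤ C := hC ⟨s, ⟨hs.1, h4⟩, rfl⟩
    rw [div_le_iff₀ hη] at h3
    linarith
  · have hs0 : 0 < s := lt_of_lt_of_le one_pos ((le_max_right s₀ 1).trans h4)
    have h5 := hs₀ s ((le_max_left s₀ 1).trans h4)
    simp only [div_le_iff₀ hs0] at h5
    exact h5.trans (mul_le_mul_of_nonneg_left hs.2 hη.le)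

lemma ae_mem_Icc_add_of_periodic {a : ℝ → ℝ} {T : ℝ} (ha : Function.Periodic a T) (ℓ : ℤ)
    {P : ℝ → Prop} {s t : ℝ} (h : ∀ᵐ y, y ∈ Icc s t → P (a y)) :
    ∀ᵐ y, y ∈ Icc (s + ℓ * T) (t + ℓ * T) → P (a y) := by
  have h1 := (measurePreserving_sub_right volume (ℓ * T)).quasiMeasurePreserving.ae h
  filter_upwards [h1] with y hy hy'
  rw [← (ha.int_mul ℓ).sub_eq y]
  exact hy ⟨by linarith [hy'.1], by linarith [hy'.2]⟩

lemma integral_add_of_periodic {a : ℝ → ℝ} {T : ℝ} (ha : Function.Periodic a T) (ℓ : ℤ) (s t : ℝ) :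
    ∫ y in (s + ℓ * T)..(t + ℓ * T), a y = ∫ y in s..t, a y := by
  rw [← intervalIntegral.integral_comp_add_right]
  exact intervalIntegral.integral_congr fun y _ => ha.int_mul ℓ y

lemma integral_signed_of_nonneg {a : ℝ → ℝ} {lam mu s t s' t' : ℝ}
    (h : ∀ᵐ y, y ∈ Icc s t → 0 ≤ a y) (hs : s ≤ s') (hst : s' ≤ t') (ht : t' ≤ t) :
    ∫ y in s'..t', (lam * max (a y) 0 - mu * max (-a y) 0) = lam * ∫ y in s'..t', a y := by
  rw [← intervalIntegral.integral_const_mul]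
  refine intervalIntegral.integral_congr_ae ?_
  filter_upwards [h] with y hy hy'
  rw [uIoc_of_le hst] at hy'
  have := hy ⟨hs.trans hy'.1.le, hy'.2.trans ht⟩
  rw [max_eq_left this, max_eq_right (by linarith)]
  ring

lemma integral_signed_of_nonpos {a : ℝ → ℝ} {lam mu s t : ℝ}
    (h : ∀ᵐ y, y ∈ Icc s t → a y ≤ 0) (hst : s ≤ t) :
    ∫ y in s..t, (lam * max (a y) 0 - mu * max (-a y) 0) = mu * ∫ y in s..t, a y := by
  rw [← intervalIntegral.integral_const_mul]
  refine intervalIntegral.integral_congr_ae ?_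
  filter_upwards [h] with y hy hy'
  rw [uIoc_of_le hst] at hy'
  have := hy ⟨hy'.1.le, hy'.2⟩
  rw [max_eq_right this, max_eq_left (by linarith)]
  ring

theorem stmt_15 (g a : ℝ → ℝ) (T : ℝ) (m : ℕ) (σ τ : ℕ → ℝ)
    (hg_cont : ContinuousOn g (Ici 0)) (hg_zero : g 0 = 0)
    (hg_pos : ∀ s : ℝ, 0 < s → 0 < g s)
    (hg0 : Tendsto (fun s => g s / s) (nhdsWithin 0 (Ioi 0)) (nhds 0))
    (hginf : Tendsto (fun s => g s / s) atTop (nhds 0))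
    (hT : 0 < T)
    (hm : 1 ≤ m)
    (hστ : ∀ i, 1 ≤ i → i ≤ m → σ i < τ i)
    (hτσ : ∀ i, 1 ≤ i → i ≤ m → τ i < σ (i + 1))
    (hσT : σ (m + 1) - σ 1 = T)
    (ha_per : ∀ t, a (t + T) = a t)
    -- `T` is the minimal period of `a`
    (ha_min : ∀ T' : ℝ, 0 < T' → (∀ t, a (t + T') = a t) → T ≤ T')
    (ha_loc : LocallyIntegrable a)
    (ha_pos : ∀ i, 1 ≤ i → i ≤ m →
      (∀ᵐ t : ℝ ∂volume, t ∈ Icc (σ i) (τ i) → 0 ≤ a t) ∧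
        0 < ∫ t in (σ i)..(τ i), a t)
    (ha_neg : ∀ i, 1 ≤ i → i ≤ m →
      (∀ᵐ t : ℝ ∂volume, t ∈ Icc (τ i) (σ (i + 1)) → a t ≤ 0) ∧
        (∫ t in (τ i)..(σ (i + 1)), a t) < 0) :
    ∀ ρ : ℝ, 0 < ρ → ∃ lamStar : ℝ, 0 < lamStar ∧
      ∀ lam : ℝ, lamStar < lam → ∃ r R : ℝ, 0 < r ∧ r < ρ ∧ ρ < R ∧
        ∃ muStar : ℝ, 0 < muStar ∧ ∀ mu : ℝ, muStar < mu →
          ∀ S : ℤ → Fin 3, (∃ j, S j ≠ 0) →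
            ∃ u v : ℝ → ℝ,
              IsSolR (fun t => lam * max (a t) 0 - mu * max (-a t) 0) g u v ∧
              (∀ t, 0 < u t) ∧
              ∀ i : ℕ, 1 ≤ i → i ≤ m → ∀ ℓ : ℤ,
                (S (i + ℓ * m) = 0 →
                  sSup (u '' Icc (σ i + ℓ * T) (τ i + ℓ * T)) < r) ∧
                (S (i + ℓ * m) = 1 →
                  r < sSup (u '' Icc (σ i + ℓ * T) (τ i + ℓ * T)) ∧
                    sSup (u '' Icc (σ i + ℓ * T) (τ i + ℓ * T)) < ρ) ∧
                (S (i + ℓ * m) = 2 →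
                  ρ < sSup (u '' Icc (σ i + ℓ * T) (τ i + ℓ * T)) ∧
                    sSup (u '' Icc (σ i + ℓ * T) (τ i + ℓ * T)) < R) := by
  intro ρ hρ
  obtain ⟨L, l₀, A₀, A₁, D, hL, hl₀, hA₀, hA₁, hD, hconst⟩ := exists_weight_constants hστ ha_loc
    (fun i h1 h2 => (ha_pos i h1 h2).2) fun i h1 h2 => (ha_neg i h1 h2).2
  obtain ⟨b, hb⟩ := exists_boundary (τ := τ) hm hσT
  have hDpos : (0 : ℝ) < D := by exact_mod_cast (by omega : 0 < D)
  have hε : 0 < l₀ / D := by positivity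
  obtain ⟨c₁, hc₁, hc₁'⟩ := exists_pos_forall_le hg_cont hg_pos (y := 2 * ρ)
    (show 0 < ρ / 2 * (l₀ / D) / L by positivity)
  refine ⟨2 * (2 * ρ) / (l₀ / D) / (c₁ * A₀), by positivity, fun lam hlam => ?_⟩
  have hlam0 : 0 < lam := lt_of_le_of_lt (by positivity) hlam
  rw [div_lt_iff₀ (by positivity)] at hlam
  have hη : 0 < 1 / (4 * L * (lam * A₁)) := by positivity
  set η := 1 / (4 * L * (lam * A₁)) with hηdef
  obtain ⟨d, hd, hd'⟩ := mem_nhdsGT_iff_exists_Ioc_subset.1 (hg0.eventually_le_const hη)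
  have hd0 : 0 < d := hd
  set r := min (d / 2) (ρ / 8)
  have hr : 0 < r := by positivity
  have hrd : 2 * r ≤ d := by linarith [min_le_left (d / 2) (ρ / 8)]
  have hrρ : r ≤ ρ / 8 := min_le_right _ _
  have hgr : ∀ s, 0 < s → s ≤ 2 * r → g s ≤ η * s := fun s h1 h2 =>
    (div_le_iff₀ h1).1 (hd' ⟨h1, h2.trans hrd⟩)
  obtain ⟨z₄, hz₄, hz₄0, hgz₄⟩ := exists_forall_le_mul hg_cont hginf hη (2 * ρ)
  obtain ⟨c, hc, hc'⟩ := exists_pos_forall_le hg_cont hg_pos (y := z₄)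
    (show 0 < r / 2 / 4 by positivity)
  refine ⟨r, 2 * z₄, hr, by linarith, by linarith, 2 * (z₄ / l₀ + z₄ / (4 * L)) / (c * A₀),
    by positivity, fun mu hmu S hS => ?_⟩
  have hmu0 : 0 < mu := lt_of_le_of_lt (by positivity) hmu
  rw [div_lt_iff₀ (by positivity)] at hmu
  set p : ShootingConstants := ⟨l₀, L, l₀ / D, lam * A₁, lam * A₀, mu * A₀, c, c₁, r / 2, 2 * r,
    ρ / 2, 2 * ρ, z₄⟩ with hpdef
  set h : ℝ → ℝ := fun s => g (max 0 (min s z₄)) with hh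
  have hηmul : ∀ ζ, ζ / (4 * L * (lam * A₁)) = η * ζ := fun ζ => by rw [hηdef]; ring
  have hh_eq : ∀ s, 0 ≤ s → s ≤ z₄ → h s = g s := fun s h1 h2 => by
    simp only [hh, min_eq_left h2, max_eq_right h1]
  have hh_zero : ∀ s ≤ 0, h s = 0 := fun s hs => by
    simp only [hh, max_eq_left ((min_le_left s z₄).trans hs), hg_zero]
  have hg_nonneg : ∀ s, 0 ≤ s → 0 ≤ g s := fun s hs => by
    rcases hs.eq_or_lt with rfl | hs
    · exact hg_zero.ge
    · exact (hg_pos s hs).le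
  have hh_small : ∀ s, 0 ≤ s → s ≤ 2 * r → h s ≤ η * s := fun s h1 h2 => by
    rcases h1.eq_or_lt with rfl | h1
    · rw [hh_zero 0 le_rfl, mul_zero]
    · rw [hh_eq s h1.le (by linarith)]
      exact hgr s h1 h2
  have hh_le : ∀ ζ, 0 ≤ ζ → ζ ≤ 2 * r → ∀ s ≤ ζ, h s ≤ η * ζ := fun ζ h1 h2 s hs => by
    rcases le_total s 0 with h3 | h3
    · rw [hh_zero s h3]
      positivity
    · exact (hh_small s h3 (hs.trans h2)).trans (mul_le_mul_of_nonneg_left hs hη.le)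
  have hh_le_z₄ : ∀ s, h s ≤ η * z₄ := fun s =>
    hgz₄ _ ⟨le_max_left _ _, max_le hz₄0.le (min_le_right _ _)⟩
  have hp : p.Nonlinearity h := by
    refine ⟨hl₀, hL, hε, by positivity, by positivity, ?_, ?_, ?_, hz₄, hc, hc₁, ?_,
      fun s => hg_nonneg _ (le_max_left _ _), hh_zero, ?_, ?_, ?_, fun s hs => ?_,
      fun s h1 h2 => ?_, ?_, ?_⟩
    · show r / 2 < 2 * r
      linarith
    · show 2 * r < ρ / 2
      linarith
    · show ρ / 2 < 2 * ρ
      linarith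
    · exact hg_cont.comp_continuous (by fun_prop) fun s => mem_Ici.2 (le_max_left _ _)
    · show ∀ s ≤ r / 2, h s ≤ r / 2 / (4 * L * (lam * A₁))
      rw [hηmul]
      exact hh_le _ (by positivity) (by linarith)
    · show ∀ s ≤ 2 * r, h s ≤ 2 * r / (4 * L * (lam * A₁))
      rw [hηmul]
      exact hh_le _ (by positivity) le_rfl
    · show ∀ s, h s ≤ z₄ / (4 * L * (lam * A₁))
      rw [hηmul]
      exact hh_le_z₄
    · replace hs : r / 2 / 4 ≤ s := hs
      have h1 : r / 2 / 4 ≤ min s z₄ := le_min hs (by linarith)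
      exact hc' _ ⟨h1.trans (le_max_right _ _), max_le hz₄0.le (min_le_right _ _)⟩
    · have h3 : 0 < ρ / 2 * (l₀ / D) / L := by positivity
      replace h1 : ρ / 2 * (l₀ / D) / L ≤ s := h1
      replace h2 : s ≤ 2 * ρ := h2
      rw [hh_eq s (by linarith) (by linarith)]
      exact hc₁' s ⟨h1, h2⟩
    · show 2 * (2 * ρ) / (l₀ / D) < c₁ * (lam * A₀)
      linarith
    · show 2 * (z₄ / l₀ + z₄ / (4 * L)) ≤ c * (mu * A₀)
      linarith
  have hpos : ∀ i, 1 ≤ i → i ≤ m → ∀ ℓ : ℤ,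
      ∀ᵐ t, t ∈ Icc (σ i + ℓ * T) (τ i + ℓ * T) → 0 ≤ a t := fun i h1 h2 ℓ =>
    ae_mem_Icc_add_of_periodic (P := fun y => 0 ≤ y) ha_per ℓ (ha_pos i h1 h2).1
  have hneg : ∀ i, 1 ≤ i → i ≤ m → ∀ ℓ : ℤ,
      ∀ᵐ t, t ∈ Icc (τ i + ℓ * T) (σ (i + 1) + ℓ * T) → a t ≤ 0 := fun i h1 h2 ℓ =>
    ae_mem_Icc_add_of_periodic (P := fun y => y ≤ 0) ha_per ℓ (ha_neg i h1 h2).1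
  have hW : p.Weight b (fun t => lam * max (a t) 0 - mu * max (-a t) 0) D := by
    have hprev : ∀ j : ℤ, ∃ i : ℕ, 1 ≤ i ∧ i ≤ m ∧ ∃ ℓ : ℤ, b (2 * j - 1) = τ i + ℓ * T ∧
        b (2 * j) = σ (i + 1) + ℓ * T := by
      intro j
      obtain ⟨i, h1, h2, ℓ, hj⟩ := exists_int_eq_add_mul hm (j - 1)
      obtain ⟨-, h4, h5⟩ := hb i h1 h2 ℓ
      rw [← hj] at h4 h5
      exact ⟨i, h1, h2, ℓ, by rw [← h4]; congr 1; ring, by rw [← h5]; congr 1; ring⟩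
    have hcur : ∀ j : ℤ, ∃ i : ℕ, 1 ≤ i ∧ i ≤ m ∧ ∃ ℓ : ℤ, b (2 * j) = σ i + ℓ * T ∧
        b (2 * j + 1) = τ i + ℓ * T := by
      intro j
      obtain ⟨i, h1, h2, ℓ, rfl⟩ := exists_int_eq_add_mul hm j
      exact ⟨i, h1, h2, ℓ, (hb i h1 h2 ℓ).1, (hb i h1 h2 ℓ).2.1⟩
    have hstep : ∀ k, 0 < b (k + 1) - b k ∧ b (k + 1) - b k ≤ L := by
      intro k
      rcases Int.even_or_odd' k with ⟨j, rfl | rfl⟩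
      · obtain ⟨i, h1, h2, ℓ, h3, h4⟩ := hcur j
        rw [h3, h4, add_sub_add_right_eq_sub]
        exact ⟨sub_pos.2 (hστ i h1 h2), (hconst i h1 h2).1⟩
      · obtain ⟨i, h1, h2, ℓ, h3, h4⟩ := hprev (j + 1)
        rw [show 2 * (j + 1) - 1 = 2 * j + 1 by ring] at h3
        rw [show 2 * j + 1 + 1 = 2 * (j + 1) by ring, h3, h4, add_sub_add_right_eq_sub]
        exact ⟨sub_pos.2 (hτσ i h1 h2), (hconst i h1 h2).2.1⟩
    refine ⟨fun k => sub_pos.1 (hstep k).1, ?_, fun j => ?_, fun j => ?_, fun k => (hstep k).2,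
      fun j => ?_, fun j => ?_, fun j => ?_, hD, fun j => ?_, fun j => ?_⟩
    · intro x
      obtain ⟨U, hU, hi⟩ := ha_loc x
      exact ⟨U, hU, (hi.pos_part.const_mul lam).sub (hi.neg_part.const_mul mu)⟩
    · obtain ⟨i, h1, h2, ℓ, h3, h4⟩ := hcur j
      rw [h3, h4]
      filter_upwards [hpos i h1 h2 ℓ] with t ht ht'
      have := ht ht'
      rw [max_eq_right (by linarith : -a t ≤ 0), mul_zero, sub_zero]
      positivity
    · obtain ⟨i, h1, h2, ℓ, h3, h4⟩ := hprev j
      rw [h3, h4]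
      filter_upwards [hneg i h1 h2 ℓ] with t ht ht'
      rw [max_eq_right (ht ht'), mul_zero, zero_sub, neg_nonpos]
      positivity
    · obtain ⟨i, h1, h2, ℓ, h3, h4⟩ := hcur j
      rw [h3, h4, add_sub_add_right_eq_sub]
      exact (hconst i h1 h2).2.2.1
    · obtain ⟨i, h1, h2, ℓ, h3, h4⟩ := hcur j
      have h5 := hστ i h1 h2
      rw [h3, h4, integral_signed_of_nonneg (hpos i h1 h2 ℓ) le_rfl (by linarith) le_rfl,
        integral_add_of_periodic ha_per]
      exact mul_le_mul_of_nonneg_left (hconst i h1 h2).2.2.2.1 hlam0.le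
    · obtain ⟨i, h1, h2, ℓ, h3, h4⟩ := hprev j
      have h5 := hτσ i h1 h2
      rw [h3, h4, integral_signed_of_nonpos (hneg i h1 h2 ℓ) (by linarith),
        integral_add_of_periodic ha_per]
      show _ ≤ -(mu * A₀)
      rw [← mul_neg]
      exact mul_le_mul_of_nonneg_left (hconst i h1 h2).2.2.2.2.2 hmu0.le
    · obtain ⟨i, h1, h2, ℓ, h3, h4⟩ := hcur j
      rw [h3, h4, add_sub_add_right_eq_sub]
      exact div_le_div_of_nonneg_right (hconst i h1 h2).2.2.1 hDpos.le
    · obtain ⟨i, h1, h2, ℓ, h3, h4⟩ := hcur j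
      have h5 := sub_pos.2 (hστ i h1 h2)
      have h6 : (τ i - σ i) / D ≤ (τ i - σ i) / 2 :=
        div_le_div_of_nonneg_left h5.le two_pos (by exact_mod_cast hD)
      have h7 : 0 < (τ i - σ i) / D := by positivity
      rw [h3, h4, add_sub_add_right_eq_sub,
        integral_signed_of_nonneg (hpos i h1 h2 ℓ) (by linarith) (by linarith) (by linarith),
        add_right_comm, add_sub_right_comm, integral_add_of_periodic ha_per]
      exact mul_le_mul_of_nonneg_left (hconst i h1 h2).2.2.2.2.1 hlam0.le
  obtain ⟨u, v, hsol, hu, hcode⟩ := hW.exists_isSolR hp S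
  have hu_pos : ∀ t, 0 < u t := by
    by_contra! hcon
    obtain ⟨t₀, ht₀⟩ := hcon
    have hzero : ∀ t, u t = 0 := hsol.eq_zero_of_eq_zero (H := η + η * z₄ / (2 * r)) hW.loc
      (fun s hs => by
        rw [abs_of_nonneg (hp.nonneg s), add_mul]
        have h2 : 0 ≤ η * s := by positivity
        have h3 : 0 ≤ η * z₄ / (2 * r) * s := by positivity
        rcases le_total s (2 * r) with h1 | h1
        · linarith [hh_small s hs h1]
        · have h4 : η * z₄ / (2 * r) * (2 * r) ≤ η * z₄ / (2 * r) * s :=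
            mul_le_mul_of_nonneg_left h1 (by positivity)
          rw [div_mul_cancel₀ _ (by positivity)] at h4
          linarith [hh_le_z₄ s])
      (fun t => (hu t).1) (le_antisymm ht₀ (hu t₀).1)
    obtain ⟨j, hj⟩ := hS
    obtain ⟨t, -, ht⟩ := (hcode j).2
    rw [hzero t] at ht
    have h3 : ∀ k : Fin 3, k ≠ 0 → 0 < p.lower k := by
      intro k hk
      fin_cases k
      · exact absurd rfl hk
      · show 0 < 2 * r
        positivity
      · show 0 < 2 * ρ
        positivity
    linarith [h3 _ hj]
  refine ⟨u, v, ⟨hsol.1, fun t₀ t => ?_⟩, hu_pos, fun i h1 h2 ℓ => ?_⟩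
  · rw [hsol.2 t₀ t]
    congr 1
    exact intervalIntegral.integral_congr fun s _ => by
      simp only [hh_eq (u s) (hu s).1 (hu s).2]
  · obtain ⟨hle, t, ht, hge⟩ := hcode (i + ℓ * m)
    rw [(hb i h1 h2 ℓ).1, (hb i h1 h2 ℓ).2.1] at hle ht
    have hub : ∀ y ∈ u '' Icc (σ i + ℓ * T) (τ i + ℓ * T), y ≤ p.upper (S (i + ℓ * m)) := by
      rintro _ ⟨s, hs, rfl⟩
      exact hle s hs
    have hsup₁ := csSup_le ⟨_, mem_image_of_mem u ht⟩ hub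
    have hsup₂ := hge.trans (le_csSup ⟨_, hub⟩ (mem_image_of_mem u ht))
    refine ⟨fun hk => ?_, fun hk => ?_, fun hk => ?_⟩ <;> rw [hk] at hsup₁ hsup₂
    · change _ ≤ r / 2 at hsup₁
      linarith
    · change _ ≤ ρ / 2 at hsup₁
      change 2 * r ≤ _ at hsup₂
      exact ⟨by linarith, by linarith⟩
    · change _ ≤ z₄ at hsup₁
      change 2 * ρ ≤ _ at hsup₂
      exact ⟨by linarith, by linarith⟩
end

section
/- Let λ, μ > 0 and R > 0, and set K := max_{i=1,…,m} ( R/|I⁺_i| + λ ‖a‖_{+,i} g*(R) ). Let Y₀ be the set of all pairs (x,y) of continuous functions ℝ → ℝ such that x is a Carathéodory solution of u'' + (λa⁺(t) − μa⁻(t)) g(u) = 0 on ℝ, y = x', and 0 ≤ x(t) ≤ R for all t ∈ ℝ. Then: (i) |y(t)| ≤ K for every (x,y) ∈ Y₀ and every t ∈ ℝ; (ii) Y₀ is a compact subset of C(ℝ, ℝ²) equipped with the topology of uniform convergence on compact subsets of ℝ; (iii) Y₀ is invariant under the shift homeomorphism ψ defined by (ψz)(t) := z(t + T), i.e. ψ(Y₀)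 = Y₀. -/
open MeasureTheory Set Filter Topology

open scoped Interval

theorem MeasureTheory.LocallyIntegrable.intervalIntegrable_of_real {f : ℝ → ℝ}
    (hf : LocallyIntegrable f) (a b : ℝ) : IntervalIntegrable f volume a b :=
  (hf.integrableOn_isCompact isCompact_uIcc).intervalIntegrable

/-- The pairs consisting of a Carathéodory solution of `u'' + q(t) g(u) = 0` on `ℝ` taking
values in `[0, R]` and its derivative. -/
def boundedSolutions (q g : ℝ → ℝ) (R : ℝ) : Set C(ℝ, ℝ × ℝ) :=
  {z | (∀ t, HasDerivAt (fun s => (z s).1) ((z t).2) t) ∧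
    (∀ t₀ t : ℝ, (z t).2 = (z t₀).2 - ∫ s in t₀..t, q s * g ((z s).1)) ∧
    ∀ t, 0 ≤ (z t).1 ∧ (z t).1 ≤ R}

namespace boundedSolutions

variable {q g : ℝ → ℝ} {R M : ℝ} {z : C(ℝ, ℝ × ℝ)}

theorem comp_add_right_mem (hz : z ∈ boundedSolutions q g R) {c : ℝ}
    (hc : Function.Periodic q c) :
    z.comp ⟨fun t => t + c, by fun_prop⟩ ∈ boundedSolutions q g R := by
  obtain ⟨h1, h2, h3⟩ := hz
  refine ⟨fun t => (h1 (t + c)).comp_add_const t c, fun t₀ t => ?_, fun t => h3 (t + c)⟩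
  have h := h2 (t₀ + c) (t + c)
  rw [← intervalIntegral.integral_comp_add_right] at h
  simp only [hc _] at h
  exact h

theorem image_comp_add_right {c : ℝ} (hc : Function.Periodic q c) :
    (fun z : C(ℝ, ℝ × ℝ) => z.comp ⟨fun t => t + c, by fun_prop⟩) '' boundedSolutions q g R =
      boundedSolutions q g R := by
  refine Subset.antisymm (image_subset_iff.2 fun z hz => comp_add_right_mem hz hc) fun z hz =>
    ⟨_, comp_add_right_mem hz hc.neg, ?_⟩
  ext t <;> simp

theorem abs_snd_sub_le (hz : z ∈ boundedSolutions q g R) (hM : ∀ x ∈ Icc 0 R, |g x| ≤ M)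
    {p : ℝ → ℝ} {s t : ℝ} (hp : IntervalIntegrable p volume s t)
    (hqp : ∀ᵐ r, r ∈ Ι s t → |q r| ≤ p r) :
    |(z t).2 - (z s).2| ≤ |∫ r in s..t, p r * M| := by
  have h : (z t).2 - (z s).2 = -∫ r in s..t, q r * g ((z r).1) := by
    rw [hz.2.1 s t]
    ring
  rw [h, abs_neg, ← Real.norm_eq_abs]
  refine intervalIntegral.norm_integral_le_abs_of_norm_le ?_ (hp.mul_const M)
  filter_upwards [ae_restrict_of_ae hqp, ae_restrict_mem measurableSet_uIoc] with r hr hmem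
  rw [Real.norm_eq_abs, abs_mul]
  exact mul_le_mul (hr hmem) (hM _ (hz.2.2 r)) (abs_nonneg _) ((abs_nonneg _).trans (hr hmem))

/-- On an interval, the derivative is bounded by the mean slope plus the total variation of the
derivative. -/
theorem abs_snd_le_of_mem_Icc (hz : z ∈ boundedSolutions q g R)
    (hM : ∀ x ∈ Icc 0 R, |g x| ≤ M) {p : ℝ → ℝ} {s r : ℝ} (hsr : s < r)
    (hp : IntervalIntegrable p volume s r) (hqp : ∀ᵐ t, t ∈ Icc s r → |q t| ≤ p t)
    {t : ℝ} (ht : t ∈ Icc s r) :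
    |(z t).2| ≤ R / (r - s) + (∫ t in s..r, p t) * M := by
  obtain ⟨c, hc, hslope⟩ := exists_hasDerivAt_eq_slope (fun s => (z s).1) (fun s => (z s).2) hsr
    (by fun_prop) fun x _ => hz.1 x
  have hcI : c ∈ Icc s r := Ioo_subset_Icc_self hc
  have hM0 : 0 ≤ M := (abs_nonneg _).trans (hM _ (hz.2.2 0))
  have hsub : Ι c t ⊆ Ι s r := by
    rw [uIoc_of_le hsr.le, uIoc]
    exact Ioc_subset_Ioc (le_min hcI.1 ht.1) (max_le hcI.2 ht.2)
  have hmemIcc : ∀ x ∈ Ι s r, x ∈ Icc s r := fun x hx => by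
    rw [uIoc_of_le hsr.le] at hx
    exact Ioc_subset_Icc_self hx
  have hc_le : |(z c).2| ≤ R / (r - s) := by
    rw [hslope, abs_div, abs_of_pos (sub_pos.2 hsr)]
    have := hz.2.2 r
    have := hz.2.2 s
    gcongr
    exact abs_le.2 ⟨by linarith, by linarith⟩
  have hvar : |(z t).2 - (z c).2| ≤ |∫ x in c..t, p x * M| := by
    refine abs_snd_sub_le hz hM (hp.mono_set_ae ?_) ?_
    · exact Eventually.of_forall hsub
    · filter_upwards [hqp] with x hx hxm using hx (hmemIcc x (hsub hxm))
  have hnonneg : 0 ≤ᵐ[volume.restrict (Ι s r)] fun x => p x * M := by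
    filter_upwards [ae_restrict_of_ae hqp, ae_restrict_mem measurableSet_uIoc] with x hx hmem
    exact mul_nonneg ((abs_nonneg _).trans (hx (hmemIcc x hmem))) hM0
  have hle := intervalIntegral.abs_integral_mono_interval hsub hnonneg (hp.mul_const M)
  have hint : 0 ≤ ∫ x in s..r, p x * M := by
    rw [uIoc_of_le hsr.le] at hnonneg
    exact intervalIntegral.integral_nonneg_of_ae_restrict hsr.le
      (by rwa [← restrict_Ioc_eq_restrict_Icc])
  rw [abs_of_nonneg hint, intervalIntegral.integral_mul_const (a := s)] at hle
  have := abs_sub_abs_le_abs_sub (z t).2 (z c).2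
  linarith

/-- The derivative is nondecreasing where the weight is nonpositive. -/
theorem snd_le_snd (hz : z ∈ boundedSolutions q g R) (hg : ∀ x ∈ Icc 0 R, 0 ≤ g x)
    {s t : ℝ} (hst : s ≤ t) (hq : ∀ᵐ r, r ∈ Icc s t → q r ≤ 0) : (z s).2 ≤ (z t).2 := by
  have h : 0 ≤ ∫ r in s..t, -(q r * g ((z r).1)) := by
    refine intervalIntegral.integral_nonneg_of_ae_restrict hst ?_
    filter_upwards [ae_restrict_of_ae hq, ae_restrict_mem measurableSet_Icc] with r hr hmem
    exact neg_nonneg.2 (mul_nonpos_of_nonpos_of_nonneg (hr hmem) (hg _ (hz.2.2 r)))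
  rw [intervalIntegral.integral_neg] at h
  linarith [hz.2.1 s t]

theorem isClosed (hq : LocallyIntegrable q) (hg : ContinuousOn g (Icc 0 R)) (hR : 0 ≤ R) :
    IsClosed (boundedSolutions q g R) := by
  let G : ℝ → ℝ := fun x => g (projIcc 0 R hR x)
  have hG : Continuous G := by
    exact (continuousOn_iff_continuous_domRestrict.1 hg).comp continuous_projIcc
  have hG_eq : ∀ x ∈ Icc 0 R, G x = g x := fun x hx => by simp only [G, projIcc_of_mem hR hx]
  obtain ⟨M, hM⟩ := (isCompact_Icc (a := (0 : ℝ)) (b := R)).exists_bound_of_continuousOn hg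
  have heq : boundedSolutions q g R =
      {z : C(ℝ, ℝ × ℝ) | ∀ s t, (z t).1 - (z s).1 = ∫ r in s..t, (z r).2} ∩
      ({z : C(ℝ, ℝ × ℝ) | ∀ s t, (z t).2 = (z s).2 - ∫ r in s..t, q r * G ((z r).1)} ∩
      {z : C(ℝ, ℝ × ℝ) | ∀ t, 0 ≤ (z t).1 ∧ (z t).1 ≤ R}) := by
    ext z
    constructor
    · rintro ⟨h1, h2, h3⟩
      refine ⟨fun s t => ?_, fun s t => ?_, h3⟩
      · rw [intervalIntegral.integral_eq_sub_of_hasDerivAt (fun x _ => h1 x)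
          (Continuous.intervalIntegrable (by fun_prop) _ _)]
      · simpa only [hG_eq _ (h3 _)] using h2 s t
    · rintro ⟨h1, h2, h3⟩
      refine ⟨fun t => ?_, fun s t => ?_, h3⟩
      · have hz2 : Continuous fun r => (z r).2 := by fun_prop
        have hz1 : (fun r => (z r).1) = fun r => (z t).1 + ∫ x in t..r, (z x).2 := by
          funext r
          rw [← h1 t r]
          ring
        rw [hz1]
        exact (hz2.integral_hasStrictDerivAt t t).hasDerivAt.const_add _
      · simpa only [hG_eq _ (h3 _)] using h2 s t
  have hev : ∀ t : ℝ, Continuous fun z : C(ℝ, ℝ × ℝ) => z t := fun t =>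
    continuous_eval_const t
  rw [heq]
  refine IsClosed.inter ?_ (IsClosed.inter ?_ ?_)
  · simp only [ofPred_forall]
    refine isClosed_iInter fun s => isClosed_iInter fun t => isClosed_eq ?_ ?_
    · exact (hev t).fst.sub (hev s).fst
    · exact intervalIntegral.continuous_parametric_intervalIntegral_of_continuous' (by fun_prop) _ _
  · simp only [ofPred_forall]
    refine isClosed_iInter fun s => isClosed_iInter fun t => isClosed_eq (hev t).snd
      ((hev s).snd.sub ?_)
    refine intervalIntegral.continuous_of_dominated_interval (bound := fun r => |q r| * M)
      (fun z => ?_) (fun z => Eventually.of_forall fun r _ => ?_) ?_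
      (Eventually.of_forall fun r _ => continuous_const.mul (hG.comp (hev r).fst))
    · refine hq.aestronglyMeasurable.restrict.mul (Continuous.aestronglyMeasurable ?_)
      fun_prop
    · rw [norm_mul, Real.norm_eq_abs]
      exact mul_le_mul_of_nonneg_left (hM _ (projIcc 0 R hR _).2) (abs_nonneg _)
    · exact (hq.intervalIntegrable_of_real _ _).abs.mul_const M
  · simp only [ofPred_forall]
    exact isClosed_iInter fun t => (isClosed_le continuous_const (hev t).fst).inter
      (isClosed_le (hev t).fst continuous_const)

theorem equicontinuous (hq : LocallyIntegrable q) (hM : ∀ x ∈ Icc 0 R, |g x| ≤ M) {K : ℝ}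
    (hK : ∀ z ∈ boundedSolutions q g R, ∀ t, |(z t).2| ≤ K) :
    Equicontinuous fun (z : boundedSolutions q g R) (t : ℝ) => z.1 t := by
  have hint : ∀ a b, IntervalIntegrable (fun r => |q r| * M) volume a b := fun a b =>
    (hq.intervalIntegrable_of_real _ _).abs.mul_const M
  intro s
  refine Metric.equicontinuousAt_of_continuity_modulus
    (fun t => max (K * |t - s|) |∫ r in s..t, |q r| * M|) ?_ _ (Eventually.of_forall ?_)
  · have hcont : Continuous fun t => max (K * |t - s|) |∫ r in s..t, |q r| * M| :=
      (by fun_prop : Continuous fun t => K * |t - s|).max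
        (intervalIntegral.continuous_primitive hint s).abs
    simpa using hcont.tendsto s
  · rintro t ⟨z, hz⟩
    rw [dist_comm, Prod.dist_eq, Real.dist_eq, Real.dist_eq]
    refine max_le_max ?_ ?_
    · exact convex_univ.norm_image_sub_le_of_norm_hasDerivWithin_le
        (f := fun r => (z r).1) (fun x _ => (hz.1 x).hasDerivWithinAt)
        (fun x _ => hK z hz x) (mem_univ s) (mem_univ t)
    · exact abs_snd_sub_le hz hM (hq.intervalIntegrable_of_real _ _).abs (Eventually.of_forall fun _ _ => le_rfl)

/-- If the derivatives are uniformly bounded, then the set of solutions with values in `[0, R]` is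
compact for uniform convergence on compact sets. -/
theorem isCompact (hq : LocallyIntegrable q) (hg : ContinuousOn g (Icc 0 R)) (hR : 0 ≤ R) {K : ℝ}
    (hK : ∀ z ∈ boundedSolutions q g R, ∀ t, |(z t).2| ≤ K) :
    IsCompact (boundedSolutions q g R) := by
  obtain ⟨M, hM⟩ := (isCompact_Icc (a := (0 : ℝ)) (b := R)).exists_bound_of_continuousOn hg
  rw [← (isClosed hq hg hR).closure_eq]
  have hT2 : T2Space (UniformOnFun ℝ (ℝ × ℝ) {S | IsCompact S}) :=
    UniformOnFun.t2Space_of_covering (sUnion_eq_univ_iff.2 fun x =>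
      ⟨{x}, isCompact_singleton, mem_singleton x⟩)
  refine ArzelaAscoli.isCompact_closure_of_isClosedEmbedding
    (F := fun (z : C(ℝ, ℝ × ℝ)) (t : ℝ) => z t) (𝔖 := {S | IsCompact S}) (fun _ hS => hS)
    ContinuousMap.isUniformEmbedding_toUniformOnFunIsCompact.isClosedEmbedding
    (fun S _ => (equicontinuous hq hM hK).equicontinuousOn S) fun _ _ t _ =>
      ⟨Icc 0 R ×ˢ Icc (-K) K, isCompact_Icc.prod isCompact_Icc, fun z hz =>
        ⟨hz.2.2 t, abs_le.1 (hK z hz t)⟩⟩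

end boundedSolutions

theorem exists_mem_Icc_of_mem_Icc_one {σ : ℕ → ℝ} {m : ℕ} (hm : 1 ≤ m) {t : ℝ}
    (ht : t ∈ Icc (σ 1) (σ (m + 1))) : ∃ i, 1 ≤ i ∧ i ≤ m ∧ t ∈ Icc (σ i) (σ (i + 1)) := by
  induction m, hm using Nat.le_induction with
  | base => exact ⟨1, le_rfl, le_rfl, ht⟩
  | succ n hn ih =>
    rcases le_total t (σ (n + 1)) with h | h
    · obtain ⟨i, hi, hin, hti⟩ := ih ⟨ht.1, h⟩
      exact ⟨i, hi, hin.trans n.le_succ, hti⟩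
    · exact ⟨n + 1, by omega, le_rfl, h, ht.2⟩

theorem stmt_16 (g a : ℝ → ℝ) (T : ℝ) (m : ℕ) (σ τ : ℕ → ℝ)
    (hg_cont : ContinuousOn g (Ici 0)) (hg_zero : g 0 = 0)
    (hg_pos : ∀ s : ℝ, 0 < s → 0 < g s)
    (hg0 : Tendsto (fun s => g s / s) (nhdsWithin 0 (Ioi 0)) (nhds 0))
    (hginf : Tendsto (fun s => g s / s) atTop (nhds 0))
    -- `g` is extended to `ℝ` by `0` on the negative half-line
    (hg_neg : ∀ s : ℝ, s ≤ 0 → g s = 0)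
    (hm : 1 ≤ m)
    (hστ : ∀ i, 1 ≤ i → i ≤ m → σ i < τ i)
    (hτσ : ∀ i, 1 ≤ i → i ≤ m → τ i < σ (i + 1))
    (hσT : σ (m + 1) - σ 1 = T)
    (ha_per : ∀ t, a (t + T) = a t)
    (ha_loc : LocallyIntegrable a)
    (ha_pos : ∀ i, 1 ≤ i → i ≤ m →
      (∀ᵐ t : ℝ ∂volume, t ∈ Icc (σ i) (τ i) → 0 ≤ a t) ∧
        0 < ∫ t in (σ i)..(τ i), a t)
    (ha_neg : ∀ i, 1 ≤ i → i ≤ m →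
      (∀ᵐ t : ℝ ∂volume, t ∈ Icc (τ i) (σ (i + 1)) → a t ≤ 0) ∧
        (∫ t in (τ i)..(σ (i + 1)), a t) < 0)
    (lam mu R : ℝ) (hlam : 0 < lam) (hmu : 0 < mu) (hR : 0 < R)
    -- `K := max_i ( R/|I⁺_i| + λ ‖a‖_{+,i} g*(R) )`
    (K : ℝ)
    (hK : K = (Finset.Icc 1 m).sup' (Finset.nonempty_Icc.mpr hm)
      (fun i => R / (τ i - σ i) +
        lam * (∫ t in (σ i)..(τ i), max (a t) 0) * sSup (g '' Icc 0 R)))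
    -- `Y₀` is the set of pairs `(x, x')` with `x` a globally defined solution of
    -- `u'' + (λ a⁺ - μ a⁻) g(u) = 0` satisfying `0 ≤ x ≤ R`
    (Y : Set C(ℝ, ℝ × ℝ))
    (hY : Y = {z : C(ℝ, ℝ × ℝ) |
      (∀ t, HasDerivAt (fun s => (z s).1) ((z t).2) t) ∧
      (∀ t₀ t : ℝ, (z t).2 = (z t₀).2 -
        ∫ s in t₀..t, (lam * max (a s) 0 - mu * max (-a s) 0) * g ((z s).1)) ∧
      ∀ t, 0 ≤ (z t).1 ∧ (z t).1 ≤ R}) :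
    -- (i) uniform bound on the derivative component
    (∀ z ∈ Y, ∀ t : ℝ, |(z t).2| ≤ K) ∧
    -- (ii) `Y₀` is compact in `C(ℝ, ℝ²)` with the compact-open topology
    --      (uniform convergence on compact sets)
    IsCompact Y ∧
    -- (iii) `Y₀` is invariant under the shift `z ↦ z(· + T)`
    (fun z : C(ℝ, ℝ × ℝ) =>
      z.comp ⟨fun t => t + T, by continuity⟩) '' Y = Y := by
  set q : ℝ → ℝ := fun s => lam * max (a s) 0 - mu * max (-a s) 0
  replace hY : Y = boundedSolutions q g R := hY
  have hq_per : Function.Periodic q T := fun t => by simp only [q, ha_per]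
  have ha_pos_loc : LocallyIntegrable fun t => max (a t) 0 := ha_loc.mono
    (ha_loc.aestronglyMeasurable.sup aestronglyMeasurable_const) (Eventually.of_forall fun t => by
      rw [Real.norm_eq_abs, Real.norm_eq_abs, abs_of_nonneg (le_max_right _ _)]
      exact max_le (le_abs_self _) (abs_nonneg _))
  have ha_neg_loc : LocallyIntegrable fun t => max (-a t) 0 := ha_loc.mono
    (ha_loc.aestronglyMeasurable.neg.sup aestronglyMeasurable_const)
    (Eventually.of_forall fun t => by
      rw [Real.norm_eq_abs, Real.norm_eq_abs, abs_of_nonneg (le_max_right _ _)]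
      exact max_le (neg_le_abs _) (abs_nonneg _))
  have hq_loc : LocallyIntegrable q := (ha_pos_loc.smul lam).sub (ha_neg_loc.smul mu)
  have hg_cont_Icc : ContinuousOn g (Icc 0 R) := hg_cont.mono Icc_subset_Ici_self
  have hg_nonneg : ∀ x, 0 ≤ g x := fun x =>
    (le_or_gt x 0).elim (fun hx => (hg_neg x hx).ge) fun hx => (hg_pos x hx).le
  have hg_le : ∀ x ∈ Icc 0 R, |g x| ≤ sSup (g '' Icc 0 R) := fun x hx => by
    rw [abs_of_nonneg (hg_nonneg x)]
    exact le_csSup (isCompact_Icc.image_of_continuousOn hg_cont_Icc).bddAbove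
      (mem_image_of_mem g hx)
  have hT : 0 < T := by
    have hmono : ∀ n, 1 ≤ n → n ≤ m → σ 1 < σ (n + 1) := by
      intro n hn
      induction n, hn using Nat.le_induction with
      | base => exact fun h => (hστ 1 le_rfl h).trans (hτσ 1 le_rfl h)
      | succ n hn ih =>
        exact fun h => (ih (by omega)).trans ((hστ _ (by omega) h).trans (hτσ _ (by omega) h))
    linarith [hmono m hm le_rfl]
  have hbound_pos : ∀ z ∈ boundedSolutions q g R, ∀ i, 1 ≤ i → i ≤ m →
      ∀ t ∈ Icc (σ i) (τ i), |(z t).2| ≤ K := by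
    intro z hz i hi him t ht
    have h := boundedSolutions.abs_snd_le_of_mem_Icc hz hg_le (p := fun t => lam * max (a t) 0)
      (hστ i hi him) ((ha_pos_loc.intervalIntegrable_of_real _ _).const_mul lam) (by
        filter_upwards [(ha_pos i hi him).1] with x hx hmem
        have hax := hx hmem
        have : q x = lam * max (a x) 0 := by simp [q, hax]
        rw [this, abs_of_nonneg (by positivity)]) ht
    rw [intervalIntegral.integral_const_mul] at h
    rw [hK]
    exact h.trans (Finset.le_sup' (fun i => R / (τ i - σ i) +
        lam * (∫ t in (σ i)..(τ i), max (a t) 0) * sSup (g '' Icc 0 R))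
        (Finset.mem_Icc.2 ⟨hi, him⟩))
  have hbound_period : ∀ z ∈ boundedSolutions q g R, ∀ t ∈ Icc (σ 1) (σ (m + 1)),
      |(z t).2| ≤ K := by
    intro z hz t ht
    obtain ⟨i, hi, him, hti⟩ := exists_mem_Icc_of_mem_Icc_one hm ht
    rcases le_total t (τ i) with h | h
    · exact hbound_pos z hz i hi him t ⟨hti.1, h⟩
    have hq_nonpos : ∀ᵐ r, r ∈ Icc (τ i) (σ (i + 1)) → q r ≤ 0 := by
      filter_upwards [(ha_neg i hi him).1] with x hx hmem
      have hax := hx hmem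
      have : 0 ≤ mu * max (-a x) 0 := by positivity
      simpa [q, hax] using this
    have hleft : (z (τ i)).2 ≤ (z t).2 :=
      boundedSolutions.snd_le_snd hz (fun x _ => hg_nonneg x) h
        (hq_nonpos.mono fun x hx hmem => hx ⟨hmem.1, hmem.2.trans hti.2⟩)
    have hright : (z t).2 ≤ (z (σ (i + 1))).2 :=
      boundedSolutions.snd_le_snd hz (fun x _ => hg_nonneg x) hti.2
        (hq_nonpos.mono fun x hx hmem => hx ⟨h.trans hmem.1, hmem.2⟩)
    have hτ := hbound_pos z hz i hi him (τ i) ⟨(hστ i hi him).le, le_rfl⟩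
    have hσ : |(z (σ (i + 1))).2| ≤ K := by
      rcases him.lt_or_eq with hlt | rfl
      · exact hbound_pos z hz (i + 1) (by omega) hlt _ ⟨le_rfl, (hστ _ (by omega) hlt).le⟩
      · have := hbound_pos _ (boundedSolutions.comp_add_right_mem hz hq_per) 1 le_rfl hm (σ 1)
          ⟨le_rfl, (hστ 1 le_rfl hm).le⟩
        rwa [show σ (i + 1) = σ 1 + T by linarith]
    exact abs_le.2 ⟨(abs_le.1 hτ).1.trans hleft, hright.trans (abs_le.1 hσ).2⟩
  have hbound : ∀ z ∈ boundedSolutions q g R, ∀ t, |(z t).2| ≤ K := by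
    intro z hz t
    obtain ⟨n, hn, -⟩ := existsUnique_add_zsmul_mem_Ico hT t (σ 1)
    have hper : Function.Periodic q (-(n • T)) := (hq_per.zsmul n).neg
    have := hbound_period _ (boundedSolutions.comp_add_right_mem hz hper) (t + n • T)
      ⟨hn.1, by linarith [hn.2]⟩
    simpa using this
  rw [hY]
  exact ⟨hbound, boundedSolutions.isCompact hq_loc hg_cont_Icc hR.le hbound,
    boundedSolutions.image_comp_add_right hq_per⟩
end
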